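/- Let T be an NTP₂ theory. If B is an extension base for ⫝^ist (for every tuple a, tp(a/B) has a global extension witnessing a ⫝^ist_B B), then forking equals dividing over B: every formula forking over B divides over B. -/

import Mathlib

open FirstOrder

universe u

namespace ForkingNTP2

variable (L : FirstOrder.Language.{u, u}) (M : Type u) [L.Structure M]

/-- Two tuples have the same (complete) type over the parameter set `A`,
computed in the monster model `M`. -/
def EqTypeOver (A : Set M) {δ : Type*} (a b : δ → M) : Prop :=
  ∀ (γ : Type u) (φ : L.Formula (δ ⊕ γ)) (c : γ → M), Set.range c ⊆ A →
    (φ.Realize (Sum.elim a c) ↔ φ.Realize (Sum.elim b c))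

/-- The family of formulas `φ(x, bs i)`, `i < ω`, is `k`-inconsistent: every
`k`-element subset is inconsistent. -/
def KInconsistent {α β : Type*} (k : ℕ) (φ : L.Formula (α ⊕ β)) (bs : ℕ → β → M) : Prop :=
  ∀ s : Finset ℕ, s.card = k → ¬ ∃ x : α → M, ∀ i ∈ s, φ.Realize (Sum.elim x (bs i))

/-- `φ(x, b)` `k`-divides over `A`. -/
def KDivides {α β : Type*} (A : Set M) (k : ℕ) (φ : L.Formula (α ⊕ β)) (b : β → M) : Prop :=
  ∃ bs : ℕ → β → M, (∀ i, EqTypeOver L M A (bs i) b) ∧ KInconsistent L M k φ bs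

/-- `φ(x, b)` divides over `A`. -/
def Divides {α β : Type*} (A : Set M) (φ : L.Formula (α ⊕ β)) (b : β → M) : Prop :=
  ∃ k, KDivides L M A k φ b

/-- `φ(x, b)` forks over `A`: it implies a finite disjunction of formulas,
each of which divides over `A`. -/
def Forks {α β : Type*} (A : Set M) (φ : L.Formula (α ⊕ β)) (b : β → M) : Prop :=
  ∃ (n : ℕ) (γ : Fin n → Type u) (ψ : ∀ i, L.Formula (α ⊕ γ i)) (c : ∀ i, γ i → M),
    (∀ i, Divides L M A (ψ i) (c i)) ∧
    ∀ x : α → M, φ.Realize (Sum.elim x b) → ∃ i, (ψ i).Realize (Sum.elim x (c i))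

/-- The complete type `tp(a / P)` forks over `A`: some formula with parameters
in `P` satisfied by `a` forks over `A`. -/
def TpForks {α : Type*} (A : Set M) (a : α → M) (P : Set M) : Prop :=
  ∃ (γ : Type u) (φ : L.Formula (α ⊕ γ)) (b : γ → M),
    Set.range b ⊆ P ∧ φ.Realize (Sum.elim a b) ∧ Forks L M A φ b

/-- `φ(x, e)` quasi divides over `A`: finitely many `A`-conjugates of `e` make
the corresponding instances inconsistent. -/
def QuasiDivides {α ε : Type*} (A : Set M) (φ : L.Formula (α ⊕ ε)) (e : ε → M) : Prop :=
  ∃ (m : ℕ) (es : Fin m → ε → M), (∀ j, EqTypeOver L M A (es j) e) ∧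
    ¬ ∃ x : α → M, ∀ j, φ.Realize (Sum.elim x (es j))

/-- `f` is an `A`-indiscernible sequence (of `β`-tuples). -/
def IndiscSeq {β : Type*} (A : Set M) (f : ℕ → β → M) : Prop :=
  ∀ (n : ℕ) (g h : Fin n → ℕ), StrictMono g → StrictMono h →
    EqTypeOver L M A (fun p : Fin n × β => f (g p.1) p.2)
      (fun p : Fin n × β => f (h p.1) p.2)

/-- The automorphism `σ` fixes the set `A` pointwise. -/
def FixesSet (σ : M ≃[L] M) (A : Set M) : Prop := ∀ a ∈ A, σ a = a

/-- `σ` is a Lascar strong automorphism over `A`: a finite product of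
automorphisms, each fixing pointwise some small model containing `A`. -/
def IsLascarStrong (κ : Cardinal.{u}) (A : Set M) (σ : M ≃[L] M) : Prop :=
  ∃ l : List (M ≃[L] M),
    (∀ τ ∈ l, ∃ N : L.ElementarySubstructure M,
      Cardinal.mk (N : Set M) < κ ∧ A ⊆ (N : Set M) ∧ FixesSet L M τ (N : Set M)) ∧
    σ = l.foldr (fun τ ρ => τ.comp ρ) (Language.Equiv.refl L M)

/-- A complete global type in variables `α`: a complete, finitely satisfiable
(in the monster) collection of formulas `φ(x, b)` with parameters `b` in `M`. -/
structure GType (α : Type u) where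
  mem : L.Formula (α ⊕ ℕ) → (ℕ → M) → Prop
  finsat : ∀ l : List (L.Formula (α ⊕ ℕ) × (ℕ → M)),
    (∀ q ∈ l, mem q.1 q.2) → ∃ x : α → M, ∀ q ∈ l, q.1.Realize (Sum.elim x q.2)
  complete : ∀ φ b, mem φ b ∨ mem φ.not b

/-- `c` realizes the restriction `p|C` of the global type `p`. -/
def GType.RealizesRestr {α : Type u} (p : GType L M α) (C : Set M) (c : α → M) : Prop :=
  ∀ (φ : L.Formula (α ⊕ ℕ)) (b : ℕ → M), p.mem φ b → Set.range b ⊆ C →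
    φ.Realize (Sum.elim c b)

/-- The global type `p` extends `tp(a / C)`. -/
def GType.Extends {α : Type u} (p : GType L M α) (a : α → M) (C : Set M) : Prop :=
  ∀ (φ : L.Formula (α ⊕ ℕ)) (b : ℕ → M), Set.range b ⊆ C →
    φ.Realize (Sum.elim a b) → p.mem φ b

/-- The global type `p` is invariant under the automorphism `σ`. -/
def GType.InvUnder {α : Type u} (p : GType L M α) (σ : M ≃[L] M) : Prop :=
  ∀ φ b, p.mem φ b ↔ p.mem φ (fun i => σ (b i))

/-- The global type `p` is (strongly) Lascar invariant over `A`. -/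
def GType.LascarInv {α : Type u} (κ : Cardinal.{u}) (A : Set M) (p : GType L M α) : Prop :=
  ∀ σ : M ≃[L] M, IsLascarStrong L M κ A σ → GType.InvUnder L M p σ

/-- The global type `p` forks over `A`. -/
def GType.ForksOver {α : Type u} (p : GType L M α) (A : Set M) : Prop :=
  ∃ (φ : L.Formula (α ⊕ ℕ)) (b : ℕ → M), p.mem φ b ∧ Forks L M A φ b

/-- `a ⫝ⁱ_A B`: `tp(a / A ∪ B)` has a global extension which is Lascar
invariant over `A`. -/
def IIndep (κ : Cardinal.{u}) {α : Type u} (A : Set M) (a : α → M) (B : Set M) : Prop :=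
  ∃ p : GType L M α, GType.Extends L M p a (A ∪ B) ∧ GType.LascarInv L M κ A p

/-- `a ⫝ⁱˢᵗ_A B`: `tp(a / A ∪ B)` has a global extension `p` which is Lascar
invariant over `A` and such that for every `C ⊇ A` and every `c ⊨ p|C`,
`tp(C / A ∪ c)` does not fork over `A` (strict invariance). -/
def IstIndep (κ : Cardinal.{u}) {α : Type u} (A : Set M) (a : α → M) (B : Set M) : Prop :=
  ∃ p : GType L M α, GType.Extends L M p a (A ∪ B) ∧ GType.LascarInv L M κ A p ∧
    ∀ C : Set M, A ⊆ C → ∀ c : α → M, GType.RealizesRestr L M p C c →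
      ¬ TpForks L M A (fun x : C => (x : M)) (A ∪ Set.range c)

/-- `T` has the tree property of the second kind. -/
def TP2 : Prop :=
  ∃ (n m k : ℕ) (φ : L.Formula ((Fin n : Type) ⊕ (Fin m : Type))) (a : ℕ → ℕ → Fin m → M),
    (∀ j : ℕ, KInconsistent L M k φ (fun i => a i j)) ∧
    ∀ f : ℕ → ℕ, ∃ x : Fin n → M, ∀ j : ℕ, φ.Realize (Sum.elim x (a (f j) j))

/-- `T` is NTP₂. -/
def NTP2 : Prop := ¬ TP2 L M

/-- `T` is dependent (NIP): no formula has the independence property. -/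
def IsNIP : Prop :=
  ¬ ∃ (n m : ℕ) (φ : L.Formula ((Fin n : Type) ⊕ (Fin m : Type)))
      (a : ℕ → Fin n → M) (b : Set ℕ → Fin m → M),
    ∀ (i : ℕ) (u : Set ℕ), φ.Realize (Sum.elim (a i) (b u)) ↔ i ∈ u

/-- Forking equals dividing over `A`. -/
def ForkEqDiv (A : Set M) : Prop :=
  ∀ (α β : Type u) (φ : L.Formula (α ⊕ β)) (b : β → M), Forks L M A φ b → Divides L M A φ b

/-- `A` is an extension base for non-forking: no type over `A` forks over `A`. -/
def ForkingExtBase (A : Set M) : Prop := ∀ (α : Type u) (a : α → M), ¬ TpForks L M A a A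

/-- Non-forking has left extension over `A`. -/
def ForkingLeftExt (A : Set M) : Prop :=
  ∀ (α δ β : Type u) (a : α → M) (bb : β → M) (d : α ⊕ δ → M), d ∘ Sum.inl = a →
    ¬ TpForks L M A a (A ∪ Set.range bb) →
    ∃ d' : α ⊕ δ → M, EqTypeOver L M (A ∪ Set.range a) d' d ∧
      ¬ TpForks L M A d' (A ∪ Set.range bb)

/-- `M` is a monster model (κ-saturated and strongly κ-homogeneous). -/
structure IsMonster (κ : Cardinal.{u}) : Prop where
  aleph0_lt : Cardinal.aleph0 < κ
  saturated : ∀ (A : Set M), Cardinal.mk A < κ → ∀ (α : Type u), Cardinal.mk α < κ →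
    ∀ S : Set (L.Formula (α ⊕ ℕ) × (ℕ → M)),
      (∀ q ∈ S, Set.range q.2 ⊆ A) →
      (∀ l : List (L.Formula (α ⊕ ℕ) × (ℕ → M)), (∀ q ∈ l, q ∈ S) →
        ∃ x : α → M, ∀ q ∈ l, q.1.Realize (Sum.elim x q.2)) →
      ∃ x : α → M, ∀ q ∈ S, q.1.Realize (Sum.elim x q.2)
  homogeneous : ∀ (A : Set M), Cardinal.mk A < κ → ∀ (α : Type u), Cardinal.mk α < κ →
    ∀ a b : α → M, EqTypeOver L M A a b →
      ∃ σ : M ≃[L] M, FixesSet L M σ A ∧ ∀ i, σ (a i) = b i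

/-- An abstract pre-independence relation `R A C B` (read `A ⫝_C B`) satisfying
properties (1)-(7): invariance, monotonicity, base monotonicity, right
extension, transitivity on the left, being stronger than invariance, and
preservation of indiscernibles. -/
structure PreIndep (κ : Cardinal.{u}) (R : Set M → Set M → Set M → Prop) : Prop where
  invariance : ∀ (σ : M ≃[L] M) (A C B : Set M),
    R A C B → R ((fun x => σ x) '' A) ((fun x => σ x) '' C) ((fun x => σ x) '' B)
  monotone : ∀ A A' C B B' : Set M, A' ⊆ A → B' ⊆ B → R A C B → R A' C B'
  baseMono : ∀ A C B D : Set M, R A C (B ∪ D) → R A (C ∪ B) D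
  rightExt : ∀ A C B D : Set M, R A C B → B ⊆ D →
    ∃ σ : M ≃[L] M, FixesSet L M σ (B ∪ C) ∧ R A C ((fun x => σ x) '' D)
  leftTrans : ∀ A₁ A₂ C B : Set M, R A₁ C B → R A₂ (C ∪ A₁) (B ∪ A₁) → R (A₁ ∪ A₂) C B
  strongerInv : ∀ A C B : Set M, R A C B →
    ∃ p : GType L M A, GType.Extends L M p (fun x : A => (x : M)) (B ∪ C) ∧
      GType.LascarInv L M κ C p
  presIndisc : ∀ (β : Type u) (f : ℕ → β → M) (A C : Set M),
    IndiscSeq L M C f → R A C (⋃ i, Set.range (f i)) → IndiscSeq L M (A ∪ C) f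

/-- `R` has left extension over `A`. -/
def LeftExtOver (R : Set M → Set M → Set M → Prop) (A : Set M) : Prop :=
  ∀ B C D : Set M, R B A C → B ⊆ D →
    ∃ σ : M ≃[L] M, FixesSet L M σ (A ∪ B) ∧ R ((fun x => σ x) '' D) A C

/-- `A` is an extension base for `R`: `a ⫝_A A` for every tuple `a`. -/
def RExtBase (R : Set M → Set M → Set M → Prop) (A : Set M) : Prop :=
  ∀ (α : Type u) (a : α → M), R (Set.range a) A A

/-- `σ` and `a` have the same Lascar strong type over `A`. -/
def EqLstp (κ : Cardinal.{u}) {ε : Type*} (A : Set M) (a b : ε → M) : Prop :=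
  ∃ σ : M ≃[L] M, IsLascarStrong L M κ A σ ∧ ∀ i, σ (a i) = b i

/-- `φ(x, e)` quasi Lascar divides over `A`. -/
def QuasiLascarDivides (κ : Cardinal.{u}) {α ε : Type*} (A : Set M)
    (φ : L.Formula (α ⊕ ε)) (e : ε → M) : Prop :=
  ∃ (m : ℕ) (es : Fin m → ε → M), (∀ j, EqLstp L M κ A e (es j)) ∧
    ¬ ∃ x : α → M, ∀ j, φ.Realize (Sum.elim x (es j))

/-- An alternation chain of length `n` for `φ(x, y)`. -/
def AltChain {α β : Type*} (φ : L.Formula (α ⊕ β)) (n : ℕ) : Prop :=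
  ∃ (as : ℕ → α → M) (b : β → M), IndiscSeq L M (∅ : Set M) as ∧
    ∀ i : ℕ, i < n - 1 →
      (φ.Realize (Sum.elim (as i) b) ↔ ¬ φ.Realize (Sum.elim (as (i + 1)) b))

/-- `k` is the alternation number of `φ`. -/
def AltNumber {α β : Type*} (φ : L.Formula (α ⊕ β)) (k : ℕ) : Prop :=
  AltChain L M φ k ∧ ∀ n : ℕ, AltChain L M φ n → n ≤ k


section Work
variable {L M}

/-- Definability with parameters `a`. -/
def Df (L : FirstOrder.Language.{u, u}) {M : Type u} [L.Structure M] {A : Type*} (a : A → M)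
    {V : Type*} (P : (V → M) → Prop) : Prop :=
  ∃ φ : L.Formula (V ⊕ A), ∀ v, P v ↔ φ.Realize (Sum.elim v a)

theorem fin_vars {V : Type*} (φ : L.Formula V) :
    ∃ (s : Finset V) (φ' : L.Formula s), ∀ v : V → M, φ.Realize v ↔ φ'.Realize (fun i => v i.1) := by
  classical
  exact ⟨φ.freeVarFinset, φ.restrictFreeVar id,
    fun v => (FirstOrder.Language.BoundedFormula.realize_restrictFreeVar v (by simp)).symm⟩

section
variable {A : Type*} {a : A → M} {V : Type*}

theorem Df.congr {P Q : (V → M) → Prop} (h : Df L a P) (hh : ∀ v, Q v ↔ P v) : Df L a Q := by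
  obtain ⟨φ, hφ⟩ := h
  exact ⟨φ, fun v => (hh v).trans (hφ v)⟩

theorem Df.not {P : (V → M) → Prop} (h : Df L a P) : Df L a (fun v => ¬ P v) := by
  obtain ⟨φ, hφ⟩ := h
  exact ⟨φ.not, fun v => by beta_reduce; rw [FirstOrder.Language.Formula.realize_not, hφ]⟩

theorem Df.and {P Q : (V → M) → Prop} (h : Df L a P) (h' : Df L a Q) :
    Df L a (fun v => P v ∧ Q v) := by
  obtain ⟨φ, hφ⟩ := h
  obtain ⟨ψ, hψ⟩ := h'
  exact ⟨φ ⊓ ψ, fun v => by beta_reduce; rw [FirstOrder.Language.Formula.realize_inf, hφ, hψ]⟩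

theorem Df.or {P Q : (V → M) → Prop} (h : Df L a P) (h' : Df L a Q) :
    Df L a (fun v => P v ∨ Q v) :=
  (h.not.and h'.not).not.congr (fun v => by tauto)

theorem Df.imp {P Q : (V → M) → Prop} (h : Df L a P) (h' : Df L a Q) :
    Df L a (fun v => P v → Q v) :=
  (h.and h'.not).not.congr (fun v => by tauto)

theorem Df.all {ι : Type*} [Finite ι] {P : ι → (V → M) → Prop} (h : ∀ i, Df L a (P i)) :
    Df L a (fun v => ∀ i, P i v) := by
  choose φ hφ using h
  refine ⟨FirstOrder.Language.BoundedFormula.iInf φ, fun v => ?_⟩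
  simp only [FirstOrder.Language.Formula.Realize,
    FirstOrder.Language.BoundedFormula.realize_iInf]
  exact forall_congr' fun i => hφ i v

theorem Df.exi {ι : Type*} [Finite ι] {P : ι → (V → M) → Prop} (h : ∀ i, Df L a (P i)) :
    Df L a (fun v => ∃ i, P i v) :=
  (Df.all fun i => (h i).not).not.congr (fun v => by push Not; rfl)

theorem Df.triv (p : Prop) : Df L a (fun _ : V → M => p) := by
  by_cases hp : p
  · exact ⟨⊤, fun v => by simp [hp]⟩
  · exact ⟨⊥, fun v => by simp [hp]⟩

theorem Df.subst {V' : Type*} {P : (V → M) → Prop} (h : Df L a P) (f : V → V' ⊕ A) :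
    Df L a (fun v' : V' → M => P (fun i => Sum.elim v' a (f i))) := by
  obtain ⟨φ, hφ⟩ := h
  refine ⟨φ.relabel (Sum.elim f Sum.inr), fun v => ?_⟩
  beta_reduce
  rw [hφ, FirstOrder.Language.Formula.realize_relabel]
  apply iff_of_eq
  congr 1
  ext (i | i) <;> simp

theorem Df.substV {V' : Type*} {P : (V → M) → Prop} (h : Df L a P) (f : V → V') :
    Df L a (fun v' : V' → M => P (fun i => v' (f i))) :=
  h.subst (fun i => Sum.inl (f i))

theorem Df.ex {W : Type*} [Nonempty M] {P : (V ⊕ W → M) → Prop} (h : Df L a P) :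
    Df L a (fun v => ∃ w : W → M, P (Sum.elim v w)) := by
  classical
  obtain ⟨φ, hφ⟩ := h
  obtain ⟨s, φ', hs⟩ := fin_vars (M := M) φ
  let W' : Type _ := {w : W // Sum.inl (Sum.inr w) ∈ s}
  have : Finite W' := by
    refine Finite.of_injective (β := s) (fun w => ⟨Sum.inl (Sum.inr w.1), w.2⟩) ?_
    intro x y hxy
    exact Subtype.ext (by simpa using hxy)
  let g : s → (V ⊕ A) ⊕ W' := fun i => match i with
    | ⟨Sum.inl (Sum.inl v), _⟩ => Sum.inl (Sum.inl v)
    | ⟨Sum.inl (Sum.inr w), hw⟩ => Sum.inr ⟨w, hw⟩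
    | ⟨Sum.inr x, _⟩ => Sum.inl (Sum.inr x)
  refine ⟨(φ'.relabel g).iExs W', fun v => ?_⟩
  rw [FirstOrder.Language.Formula.realize_iExs]
  simp only [FirstOrder.Language.Formula.realize_relabel]
  have key : ∀ w : W → M, ∀ w' : W' → M, (∀ i, w' i = w i.1) →
      (Sum.elim (Sum.elim v a) w' ∘ g) = fun i : s => Sum.elim (Sum.elim v w) a i.1 := by
    intro w w' hw
    funext i
    rcases i with ⟨(i | i) | i, hi⟩ <;> simp [g, hw]
  constructor
  · rintro ⟨w, hw⟩
    refine ⟨fun i => w i.1, ?_⟩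
    rw [key w _ (fun _ => rfl)]
    exact (hs _).1 ((hφ _).1 hw)
  · rintro ⟨w', hw⟩
    let w : W → M := fun i => if h : Sum.inl (Sum.inr i) ∈ s then w' ⟨i, h⟩ else Classical.arbitrary M
    refine ⟨w, ?_⟩
    rw [key w w' (fun i => by simp [w, i.2])] at hw
    exact (hφ _).2 ((hs _).2 hw)

theorem Df.alls {W : Type*} [Nonempty M] {P : (V ⊕ W → M) → Prop} (h : Df L a P) :
    Df L a (fun v => ∀ w : W → M, P (Sum.elim v w)) :=
  h.not.ex.not.congr (fun v => by push Not; rfl)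

/-- Weakening of parameters. -/
theorem Df.params {A' : Type*} {a' : A' → M} {P : (V → M) → Prop} (h : Df L a P)
    (f : A → A') (hf : ∀ i, a' (f i) = a i) : Df L a' P := by
  obtain ⟨φ, hφ⟩ := h
  refine ⟨φ.relabel (Sum.map id f), fun v => ?_⟩
  rw [hφ, FirstOrder.Language.Formula.realize_relabel]
  apply iff_of_eq
  congr 1
  ext (i | i) <;> simp [hf]

theorem Df.of_formula (φ : L.Formula V) : Df L a (fun v => φ.Realize v) := by
  refine ⟨φ.relabel Sum.inl, fun v => ?_⟩
  rw [FirstOrder.Language.Formula.realize_relabel]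
  rfl

end

/-- parameters coded by a sequence. -/
theorem Df.seq [Nonempty M] {V : Type*} {A : Type*} {a : A → M} {P : (V → M) → Prop} (h : Df L a P)
    [Nonempty A] :
    ∃ (φ : L.Formula (V ⊕ ℕ)) (b : ℕ → M), Set.range b ⊆ Set.range a ∧
      ∀ v, P v ↔ φ.Realize (Sum.elim v b) := by
  classical
  obtain ⟨φ, hφ⟩ := h
  obtain ⟨s, φ', hs⟩ := fin_vars (M := M) φ
  let t : Finset A := s.preimage Sum.inr (Sum.inr_injective.injOn)
  let e := t.equivFin
  let b : ℕ → M := fun n => if h : n < t.card then a (e.symm ⟨n, h⟩).1 else a (Classical.arbitrary A)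
  let g : s → V ⊕ ℕ := fun i => match i with
    | ⟨Sum.inl v, _⟩ => Sum.inl v
    | ⟨Sum.inr x, hx⟩ => Sum.inr (e ⟨x, by simpa [t] using hx⟩ : ℕ)
  refine ⟨φ'.relabel g, b, ?_, fun v => ?_⟩
  · rintro _ ⟨n, rfl⟩
    simp only [b]
    split_ifs <;> simp
  · rw [FirstOrder.Language.Formula.realize_relabel, hφ, hs]
    apply iff_of_eq
    congr 1
    funext i
    rcases i with ⟨i | i, hi⟩ <;> simp [g, b]

section core
variable {β : Type u}

/-- `K` is the consistency predicate of a definable relation. -/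
def IsSys (L : FirstOrder.Language.{u, u}) {M : Type u} [L.Structure M] {β : Type u}
    (K : Set (β → M) → Prop) : Prop :=
  ∃ (ζ : Type u) (θ : (ζ ⊕ β → M) → Prop), Df L (id : M → M) θ ∧
    ∀ S, K S ↔ ∃ z : ζ → M, ∀ y ∈ S, θ (Sum.elim z y)

/-- `K`-`k`-inconsistent rows. -/
def Kinc {Y : Type*} (K : Set Y → Prop) (k : ℕ) {m : ℕ} (I : Fin m → Y) : Prop :=
  ∀ s : Finset (Fin m), s.card = k → ¬ K (I '' (s : Set (Fin m)))

/-- Finite sets of terms. -/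
def FS {M : Type u} {β V : Type*} (T : (V → M) → Set (β → M)) : Prop :=
  ∃ (J : Type) (_ : Finite J) (τ : J → β → V ⊕ M),
    ∀ v, T v = Set.range (fun j => fun i => Sum.elim v id (τ j i))

theorem IsSys.mono {K : Set (β → M) → Prop} (h : IsSys L K) {S T : Set (β → M)} (hST : S ⊆ T)
    (hT : K T) : K S := by
  obtain ⟨ζ, θ, -, hK⟩ := h
  rw [hK] at hT ⊢
  obtain ⟨z, hz⟩ := hT
  exact ⟨z, fun y hy => hz y (hST hy)⟩

theorem IsSys.df [Nonempty M] {K : Set (β → M) → Prop} (h : IsSys L K) {V : Type*}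
    {T : (V → M) → Set (β → M)} (hT : FS T) : Df L (id : M → M) (fun v => K (T v)) := by
  obtain ⟨ζ, θ, hθ, hK⟩ := h
  obtain ⟨J, hJ, τ, hτ⟩ := hT
  have h1 : Df L (id : M → M) (fun v : V ⊕ ζ → M => ∀ j : J,
      θ (fun i => Sum.elim v id (Sum.elim (fun z => Sum.inl (Sum.inr z))
        (fun i => Sum.map Sum.inl id (τ j i)) i))) :=
    Df.all fun j => hθ.subst _
  refine h1.ex.congr fun v => ?_
  rw [hK, hτ]
  refine exists_congr fun z => ?_
  rw [Set.forall_mem_range]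
  refine forall_congr' fun j => iff_of_eq ?_
  congr 1
  funext i
  rcases i with i | i
  · simp
  · simp only [Sum.elim_inr]
    rcases τ j i with x | x <;> simp

theorem FS.const {V : Type*} {S : Set (β → M)} (hS : S.Finite) :
    FS (fun _ : V → M => S) := by
  obtain ⟨n, f, -, hf⟩ := hS.fin_param
  refine ⟨Fin n, inferInstance, fun j i => Sum.inr (f j i), fun v => ?_⟩
  simp [hf]

theorem FS.vars {V : Type*} {J : Type} [Finite J] (τ : J → β → V) :
    FS (fun v : V → M => Set.range (fun j => fun i => v (τ j i))) :=
  ⟨J, inferInstance, fun j i => Sum.inl (τ j i), fun v => by simp⟩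

theorem FS.imvars {V : Type*} {J : Type} [Finite J] (τ : J → β → V) (s : Set J) :
    FS (fun v : V → M => (fun j => fun i => v (τ j i)) '' s) :=
  ⟨s, inferInstance, fun j i => Sum.inl (τ j.1 i), fun v => by
    beta_reduce; rw [Set.image_eq_range]; simp⟩

theorem FS.var {V : Type*} (τ : β → V) :
    FS (fun v : V → M => {fun i => v (τ i)}) :=
  ⟨Unit, inferInstance, fun _ i => Sum.inl (τ i), fun v => by simp⟩

theorem FS.union {V : Type*} {S T : (V → M) → Set (β → M)} (hS : FS S) (hT : FS T) :
    FS (fun v => S v ∪ T v) := by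
  obtain ⟨J, hJ, τ, hτ⟩ := hS
  obtain ⟨J', hJ', τ', hτ'⟩ := hT
  refine ⟨J ⊕ J', inferInstance, Sum.elim τ τ', fun v => ?_⟩
  beta_reduce
  rw [hτ, hτ', ← Set.Sum.elim_range]
  congr 1
  funext j
  rcases j with j | j <;> rfl

theorem Df.kinc [Nonempty M] {K : Set (β → M) → Prop} (h : IsSys L K) {V : Type*} (k : ℕ) {m : ℕ}
    (τ : Fin m → β → V) :
    Df L (id : M → M) (fun v : V → M => Kinc K k (fun j => fun i => v (τ j i))) := by
  refine Df.all fun s => (Df.triv _).imp ?_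
  exact (h.df (FS.imvars τ (s : Set (Fin m)))).not

/-- iterated ultrafilter quantifier. -/
def It {Y : Type*} (r : Ultrafilter Y) (Ψ : Set Y → Prop) : ℕ → Set Y → Prop
  | 0, S => Ψ S
  | n + 1, S => ∀ᶠ y in (r : Filter Y), It r Ψ n (insert y S)

theorem It.not {Y : Type*} (r : Ultrafilter Y) (Ψ : Set Y → Prop) (n : ℕ) (S : Set Y) :
    It r (fun S => ¬ Ψ S) n S ↔ ¬ It r Ψ n S := by
  induction n generalizing S with
  | zero => rfl
  | succ n ih =>
    simp only [It, ih]
    exact Ultrafilter.eventually_not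

theorem exists_ultra {X ι : Type*} (Q : ι → X → Prop)
    (h : ∀ s : Finset ι, ∃ x, ∀ i ∈ s, Q i x) :
    ∃ U : Ultrafilter X, ∀ i, ∀ᶠ x in (U : Filter X), Q i x := by
  classical
  obtain ⟨U, hU⟩ := Ultrafilter.exists_ultrafilter_of_finite_inter_nonempty
    (Set.range fun i => {x | Q i x}) (by
      intro T hT
      obtain ⟨s, rfl⟩ : ∃ s : Finset ι, T = s.image (fun i => {x | Q i x}) := by
        have := Finset.subset_set_image_iff (s := Set.univ) (t := T) (f := fun i => {x | Q i x})
        rw [Set.image_univ] at this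
        obtain ⟨s, -, hs⟩ := this.1 hT
        exact ⟨s, hs.symm⟩
      obtain ⟨x, hx⟩ := h s
      exact ⟨x, by simpa using hx⟩)
  exact ⟨U, fun i => hU ⟨i, rfl⟩⟩

/-- arrays -/
def Arr {Y : Type*} (K : Set Y → Prop) (k : ℕ) : Prop :=
  ∀ n m : ℕ, ∃ A : Fin n → Fin m → Y, (∀ a, Kinc K k (A a)) ∧
    ∀ f : Fin n → Fin m, K (Set.range fun a => A a (f a))

theorem range_cons {Y : Type*} {n m : ℕ} (I : Fin m → Y) (A : Fin n → Fin m → Y)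
    (f : Fin (n+1) → Fin m) (S : Set Y) :
    S ∪ Set.range (fun a => (Fin.cons I A : Fin (n+1) → Fin m → Y) a (f a)) =
      insert (I (f 0)) S ∪ Set.range (fun a => A a (f a.succ)) := by
  have : Set.range (fun a => (Fin.cons I A : Fin (n+1) → Fin m → Y) a (f a))
      = insert (I (f 0)) (Set.range (fun a => A a (f a.succ))) := by
    ext y
    simp [Fin.exists_fin_succ, eq_comm]
  rw [this, Set.insert_union, Set.union_insert]

theorem arr_of_rows {Y : Type*} {K : Set Y → Prop} {k : ℕ} (r : Ultrafilter Y)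
    (hr : ∀ G : Set Y, (∀ᶠ y in (r : Filter Y), y ∈ G) → ∀ m, ∃ I : Fin m → Y, (∀ t, I t ∈ G) ∧ Kinc K k I)
    (hK : ∀ n, It r K n ∅) : Arr K k := by
  have main : ∀ (n m : ℕ) (J : Type) [Finite J] (S : J → Set Y), (∀ j, It r K n (S j)) →
      ∃ A : Fin n → Fin m → Y, (∀ a, Kinc K k (A a)) ∧
        ∀ j, ∀ f : Fin n → Fin m, K (S j ∪ Set.range fun a => A a (f a)) := by
    intro n m
    induction n with
    | zero =>
      intro J _ S hS
      exact ⟨fun a => a.elim0, fun a => a.elim0, fun j f => by simpa [It] using hS j⟩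
    | succ n ih =>
      intro J _ S hS
      obtain ⟨I, hI, hIk⟩ := hr {y | ∀ j, It r K n (insert y (S j))} (Filter.eventually_all.2 hS) m
      obtain ⟨A, hA, hA'⟩ := ih (J × Fin m) (fun q => insert (I q.2) (S q.1))
        (fun q => hI q.2 q.1)
      refine ⟨Fin.cons I A, fun a => ?_, fun j f => ?_⟩
      · refine Fin.cases ?_ (fun a => ?_) a
        · simpa using hIk
        · simpa using hA a
      · rw [range_cons]
        exact hA' (j, f 0) (fun a => f a.succ)
  intro n m
  obtain ⟨A, hA, hA'⟩ := main n m Unit (fun _ => ∅) (fun _ => hK n)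
  exact ⟨A, hA, fun f => by simpa using hA' () f⟩

theorem Kinc.comp {Y : Type*} {K : Set Y → Prop} {k : ℕ} {m N : ℕ} {I : Fin N → Y}
    (h : Kinc K k I) (e : Fin m ↪ Fin N) : Kinc K k (fun t => I (e t)) := by
  intro s hs
  have := h (s.map e) (by simpa using hs)
  simpa [Set.image_image] using this

/-- `r` and `P` have the same definable sets. -/
def Agree (L : FirstOrder.Language.{u, u}) {M : Type u} [L.Structure M] {β : Type u}
    (P r : Ultrafilter (β → M)) : Prop :=
  ∀ D : (β → M) → Prop, Df L (id : M → M) D → (∀ᶠ y in (P : Filter (β → M)), D y) →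
    ∀ᶠ y in (r : Filter (β → M)), D y

theorem Agree.symm {P r : Ultrafilter (β → M)} (h : Agree L P r) : Agree L r P := by
  intro D hD hr
  by_contra hP
  have := h _ hD.not (Ultrafilter.eventually_not.2 hP)
  exact (Ultrafilter.eventually_not.1 this) hr

/-- Dividing, finitary form. -/
def Dv (L : FirstOrder.Language.{u, u}) {M : Type u} [L.Structure M] {β : Type u}
    (P : Ultrafilter (β → M)) (K : Set (β → M) → Prop) (k : ℕ) : Prop :=
  ∀ D : (β → M) → Prop, Df L (id : M → M) D → (∀ᶠ y in (P : Filter (β → M)), D y) →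
    ∀ N : ℕ, ∃ I : Fin N → β → M, (∀ t, D (I t)) ∧ Kinc K k I

/-- rich sets -/
def Rich {Y : Type*} (K : Set Y → Prop) (k : ℕ) (G : Set Y) : Prop :=
  ∀ m : ℕ, ∃ I : Fin m → Y, (∀ t, I t ∈ G) ∧ Kinc K k I

theorem Rich.union {Y : Type*} {K : Set Y → Prop} {k : ℕ} {G H : Set Y}
    (h : Rich K k (G ∪ H)) : Rich K k G ∨ Rich K k H := by
  classical
  by_contra hc
  push Not at hc
  obtain ⟨h1, h2⟩ := hc
  unfold Rich at h1 h2
  push Not at h1 h2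
  obtain ⟨m1, h1⟩ := h1
  obtain ⟨m2, h2⟩ := h2
  obtain ⟨I, hI, hk⟩ := h (m1 + m2)
  let s : Finset (Fin (m1+m2)) := Finset.univ.filter (fun t => I t ∈ G)
  have hs : m1 ≤ s.card ∨ m2 ≤ sᶜ.card := by
    have := Finset.card_add_card_compl s
    simp only [Fintype.card_fin] at this
    omega
  have key : ∀ (u : Finset (Fin (m1+m2))) (m : ℕ), m ≤ u.card →
      ∃ e : Fin m ↪ Fin (m1+m2), ∀ t, e t ∈ u := by
    intro u m hm
    obtain ⟨u', hu', hc⟩ := Finset.exists_subset_card_eq hm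
    exact ⟨(u'.orderEmbOfFin hc).toEmbedding, fun t => hu' (Finset.orderEmbOfFin_mem u' hc t)⟩
  rcases hs with hs | hs
  · obtain ⟨e, he⟩ := key _ _ hs
    exact h1 _ (fun t => by simpa [s] using he t) (hk.comp e)
  · obtain ⟨e, he⟩ := key _ _ hs
    refine h2 (fun t => I (e t)) (fun t => ?_) (hk.comp e)
    have := he t
    simp only [s, Finset.mem_compl, Finset.mem_filter, Finset.mem_univ, true_and] at this
    exact (hI (e t)).resolve_left this

theorem exists_rich {P : Ultrafilter (β → M)} {K : Set (β → M) → Prop} {k : ℕ} (h : Dv L P K k)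
    (hK : IsSys L K) :
    ∃ r : Ultrafilter (β → M), Agree L P r ∧ ∀ G : Set (β → M),
      (∀ᶠ y in (r : Filter (β → M)), y ∈ G) → Rich K k G := by
  classical
  let ι₁ := {D : (β → M) → Prop // Df L (id : M → M) D ∧ ∀ᶠ y in (P : Filter (β → M)), D y}
  let ι₂ := {G : Set (β → M) // ¬ Rich K k G}
  obtain ⟨r, hr⟩ := exists_ultra (X := β → M) (ι := ι₁ ⊕ ι₂)
    (Sum.elim (fun D y => D.1 y) (fun G y => y ∉ G.1)) (by
      intro s
      by_contra hc
      push Not at hc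
      have hrich : ∀ s : Finset (ι₁ ⊕ ι₂), ∀ D : (β → M) → Prop, Df L (id : M → M) D →
          (∀ᶠ y in (P : Filter (β → M)), D y) →
          Rich K k {y | D y ∧ ∀ i ∈ s, Sum.elim (fun (D : ι₁) y => D.1 y)
            (fun (G : ι₂) y => y ∉ G.1) i y} := by
        intro s
        induction s using Finset.induction_on with
        | empty => intro D hD hP; simpa [Rich] using h D hD hP
        | insert i s hi ih =>
          intro D hD hP
          rcases i with ⟨D', hD', hP'⟩ | ⟨G, hG⟩
          · have := ih (fun y => D y ∧ D' y) (hD.and hD') (hP.and hP')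
            simpa [and_assoc] using this
          · have := ih D hD hP
            have h2 : {y | D y ∧ ∀ i ∈ s, Sum.elim (fun (D : ι₁) y => D.1 y)
                (fun (G : ι₂) y => y ∉ G.1) i y} ⊆ G ∪ {y | D y ∧ ∀ i ∈ insert (Sum.inr ⟨G, hG⟩) s,
                  Sum.elim (fun (D : ι₁) y => D.1 y) (fun (G : ι₂) y => y ∉ G.1) i y} := by
              intro y hy
              by_cases hyG : y ∈ G
              · exact Or.inl hyG
              · exact Or.inr ⟨hy.1, by simpa [hyG] using hy.2⟩
            refine (Rich.union (G := G) fun m => ?_).resolve_left hG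
            obtain ⟨I, hI, hI'⟩ := this m
            exact ⟨I, fun t => h2 (hI t), hI'⟩
      obtain ⟨I, hI, -⟩ := hrich s (fun _ => True) (Df.triv _) (by simp) 1
      obtain ⟨i, hi, hi'⟩ := hc (I 0)
      exact hi' ((hI 0).2 i hi))
  refine ⟨r, fun D hD hP => hr (Sum.inl ⟨D, hD, hP⟩), fun G hG => ?_⟩
  by_contra hn
  exact (Ultrafilter.eventually_not.1 (hr (Sum.inr ⟨G, hn⟩))) hG

/-- no arrays for definable systems -/
def NoArr (L : FirstOrder.Language.{u, u}) (M : Type u) [L.Structure M] (β : Type u) : Prop :=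
  ∀ (K : Set (β → M) → Prop) (k : ℕ), IsSys L K → ¬ Arr K k

theorem exists_coheir (hN : NoArr L M β) {P : Ultrafilter (β → M)} {K : Set (β → M) → Prop} {k : ℕ}
    (h : Dv L P K k) (hK : IsSys L K) :
    ∃ r : Ultrafilter (β → M), Agree L P r ∧ ∃ n, It r (fun S => ¬ K S) n ∅ := by
  obtain ⟨r, hr, hrich⟩ := exists_rich h hK
  refine ⟨r, hr, ?_⟩
  by_contra hc
  push Not at hc
  exact hN K k hK (arr_of_rows r hrich (fun n => by
    have := hc n
    rw [It.not] at this
    exact not_not.1 this))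

end core

section core2
variable {β : Type u}

theorem qd [Nonempty M] (hN : NoArr L M β) {P : Ultrafilter (β → M)} (n : ℕ) :
    ∀ (K : Fin n → Set (β → M) → Prop) (k : Fin n → ℕ), (∀ i, IsSys L (K i)) →
      (∀ i, Dv L P (K i) (k i)) →
      ∃ (J : Type) (_ : Finite J), ∀ D : (β → M) → Prop, Df L (id : M → M) D →
        (∀ᶠ y in (P : Filter (β → M)), D y) →
        ∃ b : J → β → M, (∀ t, D (b t)) ∧ ∀ c : J → Fin n, ∃ i, ¬ K i (b '' {t | c t = i}) := by
  induction n with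
  | zero =>
    intro K k _ _
    refine ⟨Unit, inferInstance, fun D _ hP => ?_⟩
    obtain ⟨y, hy⟩ := hP.exists
    exact ⟨fun _ => y, fun _ => hy, fun c => (c ()).elim0⟩
  | succ n ih =>
    intro K k hK hD
    obtain ⟨r, hr, N, hrN⟩ := exists_coheir hN (hD 0) (hK 0)
    obtain ⟨Jb, hJb, hb⟩ := ih (fun i => K i.succ) (fun i => k i.succ) (fun i => hK _) (fun i => hD _)
    have inner : ∀ h : ℕ, ∃ (J : Type) (_ : Finite J), ∀ D : (β → M) → Prop, Df L (id : M → M) D →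
        (∀ᶠ y in (P : Filter (β → M)), D y) → ∀ S : Set (β → M), S.Finite →
        It r (fun S => ¬ K 0 S) h S →
        ∃ b : J → β → M, (∀ t, D (b t)) ∧ ∀ c : J → Fin (n+1),
          ¬ K 0 (S ∪ b '' {t | c t = 0}) ∨ ∃ i : Fin n, ¬ K i.succ (b '' {t | c t = i.succ}) := by
      intro h
      induction h with
      | zero =>
        refine ⟨Empty, inferInstance, fun D _ _ S _ hS => ⟨fun t => t.elim, fun t => t.elim,
          fun c => Or.inl ?_⟩⟩
        have h0 : (fun t : Empty => (t.elim : β → M)) '' {t | c t = 0} = ∅ := by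
          ext y; simp
        rw [h0, Set.union_empty]
        exact hS
      | succ h ihh =>
        obtain ⟨J, hJ, hJ'⟩ := ihh
        refine ⟨Jb ⊕ Jb × J, inferInstance, fun D hDd hDP S hS hIt => ?_⟩
        let G : (β → M) → Prop := fun y => ∃ w : J × β → M, (∀ t, D (fun i => w (t, i))) ∧
          ∀ c : J → Fin (n+1), ¬ K 0 (({y} ∪ S) ∪ (fun t => fun i => w (t, i)) '' {t | c t = 0}) ∨
            ∃ i : Fin n, ¬ K i.succ ((fun t => fun i => w (t, i)) '' {t | c t = i.succ})
        have hG : Df L (id : M → M) G := by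
          have : Df L (id : M → M) (fun v : β ⊕ (J × β) → M =>
            (∀ t, D (fun i => v (Sum.inr (t, i)))) ∧
            ∀ c : J → Fin (n+1),
              ¬ K 0 (({fun i => v (Sum.inl i)} ∪ S) ∪
                (fun t => fun i => v (Sum.inr (t, i))) '' {t | c t = 0}) ∨
              ∃ i : Fin n, ¬ K i.succ ((fun t => fun i => v (Sum.inr (t, i))) '' {t | c t = i.succ})) := by
            refine (Df.all fun t => hDd.substV (fun i => Sum.inr (t, i))).and (Df.all fun c => ?_)
            refine Df.or ?_ (Df.exi fun i => ?_)
            · exact ((hK 0).df (((FS.var _).union (FS.const hS)).union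
                (FS.imvars (fun t i => Sum.inr (t, i)) {t | c t = 0}))).not
            · exact ((hK i.succ).df (FS.imvars (fun t i => Sum.inr (t, i)) {t | c t = i.succ})).not
          exact this.ex
        have hGr : ∀ᶠ y in (r : Filter (β → M)), G y := by
          refine Filter.Eventually.mono hIt fun y hy => ?_
          obtain ⟨b, hb1, hb2⟩ := hJ' D hDd hDP (insert y S) (hS.insert y) hy
          exact ⟨fun q => b q.1 q.2, hb1, fun c => by simpa [Set.insert_union] using hb2 c⟩
        have hGP := hr.symm G hG hGr
        obtain ⟨b, hb1, hb2⟩ := hb _ (hDd.and hG) (hDP.and hGP)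
        choose hb1 w hw1 hw2 using hb1
        refine ⟨Sum.elim b (fun q i => w q.1 (q.2, i)), ?_, fun c => ?_⟩
        · rintro (t | ⟨t, t'⟩)
          · exact hb1 t
          · exact hw1 t t'
        · by_cases hc : ∃ t0, c (Sum.inl t0) = 0
          · obtain ⟨t0, ht0⟩ := hc
            rcases hw2 t0 (fun t => c (Sum.inr (t0, t))) with h1 | ⟨i, h1⟩
            · refine Or.inl fun h2 => h1 ((hK 0).mono ?_ h2)
              rintro y ((hy | hy) | ⟨t, ht, rfl⟩)
              · exact Or.inr ⟨Sum.inl t0, ht0, hy.symm⟩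
              · exact Or.inl hy
              · exact Or.inr ⟨Sum.inr (t0, t), ht, rfl⟩
            · refine Or.inr ⟨i, fun h2 => h1 ((hK _).mono ?_ h2)⟩
              rintro y ⟨t, ht, rfl⟩
              exact ⟨Sum.inr (t0, t), ht, rfl⟩
          · push Not at hc
            obtain ⟨i, hi⟩ := hb2 (fun t => (c (Sum.inl t)).pred (hc t))
            refine Or.inr ⟨i, fun h2 => hi ((hK _).mono ?_ h2)⟩
            rintro y ⟨t, ht, rfl⟩
            refine ⟨Sum.inl t, ?_, rfl⟩
            simp only [Set.mem_ofPred_eq] at ht ⊢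
            rw [← ht, Fin.succ_pred]
    obtain ⟨J, hJ, hJ'⟩ := inner N
    refine ⟨J, hJ, fun D hDd hP => ?_⟩
    obtain ⟨b, hb1, hb2⟩ := hJ' D hDd hP ∅ Set.finite_empty hrN
    refine ⟨b, hb1, fun c => ?_⟩
    rcases hb2 c with h1 | ⟨i, h1⟩
    · exact ⟨0, by simpa using h1⟩
    · exact ⟨i.succ, h1⟩

/-- strictness for ultrafilters -/
def StrictU (L : FirstOrder.Language.{u, u}) {M : Type u} [L.Structure M] {β : Type u}
    (P s : Ultrafilter (β → M)) : Prop :=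
  ∀ (K : Set (β → M) → Prop) (k : ℕ), IsSys L K → Dv L P K k → ∀ G : Set (β → M),
    (∀ᶠ y in (s : Filter (β → M)), y ∈ G) → ¬ ∀ F ⊆ G, F.Finite → K F

theorem exists_strict [Nonempty M] (hN : NoArr L M β) (P : Ultrafilter (β → M)) :
    ∃ s : Ultrafilter (β → M), Agree L P s ∧ StrictU L P s := by
  classical
  let ι₁ := {D : (β → M) → Prop // Df L (id : M → M) D ∧ ∀ᶠ y in (P : Filter (β → M)), D y}
  let ι₂ := {G : Set (β → M) // ∃ (K : Set (β → M) → Prop) (k : ℕ), IsSys L K ∧ Dv L P K k ∧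
    ∀ F ⊆ G, F.Finite → K F}
  obtain ⟨r, hr⟩ := exists_ultra (X := β → M) (ι := ι₁ ⊕ ι₂)
    (Sum.elim (fun D y => D.1 y) (fun G y => y ∉ G.1)) (by
      intro s
      by_contra hc
      push Not at hc
      have f1 : Finite {i : ι₁ // Sum.inl i ∈ s} :=
        Finite.of_injective (β := s) (fun w => ⟨Sum.inl w.1, w.2⟩)
          (fun x y hxy => Subtype.ext (by simpa using hxy))
      have f2 : Finite {i : ι₂ // Sum.inr i ∈ s} :=
        Finite.of_injective (β := s) (fun w => ⟨Sum.inr w.1, w.2⟩)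
          (fun x y hxy => Subtype.ext (by simpa using hxy))
      obtain ⟨n, ⟨e⟩⟩ := Finite.exists_equiv_fin {i : ι₂ // Sum.inr i ∈ s}
      have hG : ∀ i : Fin n, ∃ (K : Set (β → M) → Prop) (k : ℕ), IsSys L K ∧ Dv L P K k ∧
        ∀ F ⊆ (e.symm i).1.1, F.Finite → K F := fun i => (e.symm i).1.2
      choose K k h1 h2 h3 using hG
      obtain ⟨J, hJ, hJ'⟩ := qd hN n K k h1 h2
      obtain ⟨b, hb, hb'⟩ := hJ' (fun y => ∀ i : {i : ι₁ // Sum.inl i ∈ s}, i.1.1 y)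
        (Df.all fun i => i.1.2.1) (Filter.eventually_all.2 fun i => i.1.2.2)
      have hcol : ∀ t, ∃ i : Fin n, b t ∈ (e.symm i).1.1 := by
        intro t
        obtain ⟨i, hi, hi'⟩ := hc (b t)
        rcases i with i | i
        · exact absurd (hb t ⟨i, hi⟩) hi'
        · refine ⟨e ⟨i, hi⟩, ?_⟩
          simpa using hi'
      choose c hcc using hcol
      obtain ⟨i, hi⟩ := hb' c
      refine hi (h3 i _ ?_ (Set.toFinite _))
      rintro _ ⟨t, rfl, rfl⟩
      exact hcc t)
  refine ⟨r, fun D hD hP => hr (Sum.inl ⟨D, hD, hP⟩), fun K k hK hD G hG hF => ?_⟩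
  exact (Ultrafilter.eventually_not.1 (hr (Sum.inr ⟨G, K, k, hK, hD, hF⟩))) hG

theorem kim [Nonempty M] (hN : NoArr L M β) {P s : Ultrafilter (β → M)} (hs : StrictU L P s)
    {K : Set (β → M) → Prop} {k : ℕ} (hK : IsSys L K) (hD : Dv L P K k) :
    ∃ n, It s (fun S => ¬ K S) n ∅ := by
  classical
  by_contra hc
  push Not at hc
  have hIt : ∀ n, It s K n ∅ := fun n => by
    have := hc n
    rw [It.not] at this
    exact not_not.1 this
  refine hN K k hK ?_
  have main : ∀ (m n : ℕ) (J : Type u) [Finite J] (S : J → Set (β → M)), (∀ j, (S j).Finite) →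
      (∀ j, It s K n (S j)) →
      ∃ A : Fin n → Fin m → β → M, (∀ a, Kinc K k (A a)) ∧
        ∀ j, ∀ f : Fin n → Fin m, K (S j ∪ Set.range fun a => A a (f a)) := by
    intro m n
    induction n with
    | zero =>
      intro J _ S _ hS
      exact ⟨fun a => a.elim0, fun a => a.elim0, fun j f => by simpa [It] using hS j⟩
    | succ n ih =>
      intro J _ S hSf hS
      let G : Set (β → M) := {y | ∀ j, It s K n (insert y (S j))}
      have hG : ∀ᶠ y in (s : Filter (β → M)), y ∈ G := Filter.eventually_all.2 hS
      let K' : Set (β → M) → Prop := fun F => ∃ w : ULift.{u} (Fin n × Fin m) × β → M,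
        ∀ y ∈ F, (∀ a, Kinc K k (fun t => fun i => w (⟨(a, t)⟩, i))) ∧
          ∀ j, ∀ f : Fin n → Fin m, K (({y} ∪ S j) ∪ Set.range fun a => fun i => w (⟨(a, f a)⟩, i))
      have hK' : IsSys L K' := by
        refine ⟨ULift.{u} (Fin n × Fin m) × β, fun v =>
          (∀ a, Kinc K k (fun t => fun i => v (Sum.inl (⟨(a, t)⟩, i)))) ∧
          ∀ j, ∀ f : Fin n → Fin m, K (({fun i => v (Sum.inr i)} ∪ S j) ∪
            Set.range fun a => fun i => v (Sum.inl (⟨(a, f a)⟩, i))), ?_, fun S => Iff.rfl⟩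
        refine Df.and (Df.all fun a => Df.kinc hK k (fun t i => Sum.inl (ULift.up (a, t), i)))
          (Df.all fun j => Df.all fun f => ?_)
        exact hK.df (((FS.var _).union (FS.const (hSf j))).union
          (FS.vars fun a i => Sum.inl (ULift.up (a, f a), i)))
      have hK'F : ∀ F ⊆ G, F.Finite → K' F := by
        intro F hFG hF
        have : Finite F := hF
        obtain ⟨A, hA, hA'⟩ := ih (J × F) (fun q => insert q.2.1 (S q.1)) (fun q => (hSf _).insert _)
          (fun q => hFG q.2.2 q.1)
        refine ⟨fun q => A q.1.down.1 q.1.down.2 q.2, fun y hy => ⟨hA, fun j f => ?_⟩⟩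
        simpa [Set.insert_union] using hA' (j, ⟨y, hy⟩) f
      have hnD : ¬ Dv L P K' m := fun h => hs K' m hK' h G hG hK'F
      obtain ⟨I, hI, hIK⟩ : ∃ I : Fin m → β → M, Kinc K k I ∧ K' (Set.range I) := by
        by_contra hno
        push Not at hno
        refine hnD fun D hDd hDP N => ?_
        obtain ⟨I, hI, hIk⟩ := hD D hDd hDP N
        refine ⟨I, hI, fun u hu hKu => ?_⟩
        refine hno _ (hIk.comp (u.orderEmbOfFin hu).toEmbedding) ?_
        refine hK'.mono ?_ hKu
        rintro _ ⟨t, rfl⟩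
        exact ⟨_, Finset.orderEmbOfFin_mem u hu t, rfl⟩
      obtain ⟨w, hw⟩ := hIK
      have hA' : ∃ A : Fin n → Fin m → β → M, (∀ a, Kinc K k (A a)) ∧ ∀ t j, ∀ f : Fin n → Fin m,
          K (({I t} ∪ S j) ∪ Set.range fun a => A a (f a)) := by
        by_cases hm : Nonempty (Fin m)
        · exact ⟨fun a t i => w (⟨(a, t)⟩, i), (hw (I hm.some) ⟨_, rfl⟩).1,
            fun t j f => (hw (I t) ⟨t, rfl⟩).2 j f⟩
        · refine ⟨fun a t => (hm ⟨t⟩).elim, fun a => ?_, fun t => (hm ⟨t⟩).elim⟩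
          have : I = fun t => (hm ⟨t⟩).elim := funext fun t => (hm ⟨t⟩).elim
          rw [← this]
          exact hI
      obtain ⟨A, hA, hA'⟩ := hA'
      refine ⟨Fin.cons I A, fun a => ?_, fun j f => ?_⟩
      · refine Fin.cases ?_ (fun a => ?_) a
        · simpa using hI
        · simpa using hA a
      · rw [range_cons]
        simpa [Set.insert_union] using hA' (f 0) j (fun a => f a.succ)
  intro n m
  obtain ⟨A, hA, hA'⟩ := main m n PUnit (fun _ => ∅) (fun _ => Set.finite_empty) (fun _ => hIt n)
  exact ⟨A, hA, fun f => by simpa using hA' ⟨⟩ f⟩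

end core2

section core3
variable {β : Type u}

theorem It.mono_set {Y : Type*} {r : Ultrafilter Y} {Ψ : Set Y → Prop}
    (hΨ : ∀ S T, S ⊆ T → Ψ S → Ψ T) (n : ℕ) : ∀ {S T : Set Y}, S ⊆ T → It r Ψ n S → It r Ψ n T := by
  induction n with
  | zero => intro S T h; exact hΨ S T h
  | succ n ih =>
    intro S T h hS
    exact Filter.Eventually.mono hS fun y hy => ih (Set.insert_subset_insert h) hy

theorem It.mono_nat {Y : Type*} {r : Ultrafilter Y} {Ψ : Set Y → Prop}
    (hΨ : ∀ S T, S ⊆ T → Ψ S → Ψ T) {n m : ℕ} (hnm : n ≤ m) {S : Set Y} (h : It r Ψ n S) :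
    It r Ψ m S := by
  induction hnm with
  | refl => exact h
  | step _ ih =>
    exact Filter.Eventually.of_forall fun y => It.mono_set hΨ _ (Set.subset_insert y S) ih

theorem exists_row {Y : Type*} (s : Ultrafilter Y) {ι : Type*} [Finite ι] (Ψ : ι → Set Y → Prop)
    (N0 : ℕ) (hΨ : ∀ i, It s (Ψ i) N0 ∅) (E : Y → Prop) (hE : ∀ᶠ y in (s : Filter Y), E y) (N : ℕ) :
    ∃ I : ℕ → Y, (∀ t < N, E (I t)) ∧ ∀ i, ∀ F : Finset ℕ, F ⊆ Finset.range N → F.card ≤ N0 →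
      It s (Ψ i) (N0 - F.card) (I '' (F : Set ℕ)) := by
  classical
  induction N with
  | zero =>
    obtain ⟨y, hy⟩ := hE.exists
    refine ⟨fun _ => y, fun t ht => absurd ht (by omega), fun i F hF _ => ?_⟩
    have : F = ∅ := by simpa using hF
    subst this
    simpa using hΨ i
  | succ N ih =>
    obtain ⟨I, hI, hI'⟩ := ih
    have ev : ∀ᶠ y in (s : Filter Y), E y ∧ ∀ i, ∀ F : (Finset.range N).powerset, F.1.card < N0 →
        It s (Ψ i) (N0 - (F.1.card + 1)) (insert y (I '' (F.1 : Set ℕ))) := by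
      refine hE.and (Filter.eventually_all.2 fun i => Filter.eventually_all.2 fun F => ?_)
      by_cases hF : F.1.card < N0
      · have := hI' i F.1 (Finset.mem_powerset.1 F.2) hF.le
        obtain ⟨d, hd⟩ : ∃ d, N0 - F.1.card = d + 1 := ⟨N0 - F.1.card - 1, by omega⟩
        rw [hd] at this
        have hd' : N0 - (F.1.card + 1) = d := by omega
        rw [hd']
        exact Filter.Eventually.mono this fun y hy _ => hy
      · exact Filter.Eventually.of_forall fun y h => absurd h hF
    obtain ⟨y, hy, hy'⟩ := ev.exists
    have hup : ∀ F : Finset ℕ, F ⊆ Finset.range N →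
        Function.update I N y '' (F : Set ℕ) = I '' (F : Set ℕ) := by
      intro F hF
      refine Set.image_congr fun t ht => ?_
      have := Finset.mem_range.1 (hF ht)
      exact Function.update_of_ne (by omega) _ _
    refine ⟨Function.update I N y, fun t ht => ?_, fun i F hF hFc => ?_⟩
    · by_cases htN : t = N
      · subst htN; simpa using hy
      · rw [Function.update_of_ne htN]; exact hI t (by omega)
    · by_cases hN : N ∈ F
      · have hF' : F.erase N ⊆ Finset.range N := by
          intro t ht
          have h1 := Finset.mem_range.1 (hF (Finset.mem_of_mem_erase ht))
          have h2 := Finset.ne_of_mem_erase ht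
          exact Finset.mem_range.2 (by omega)
        have hc : (F.erase N).card + 1 = F.card := Finset.card_erase_add_one hN
        have := hy' i ⟨F.erase N, Finset.mem_powerset.2 hF'⟩ (by dsimp only; omega)
        dsimp only at this
        rw [hc, ← hup _ hF'] at this
        rw [← Finset.insert_erase hN, Finset.coe_insert, Set.image_insert_eq, Function.update_self,
          Finset.insert_erase hN]
        exact this
      · have hF' : F ⊆ Finset.range N := by
          intro t ht
          have h1 := Finset.mem_range.1 (hF ht)
          have h2 : t ≠ N := fun h => hN (h ▸ ht)
          exact Finset.mem_range.2 (by omega)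
        rw [hup F hF']
        exact hI' i F hF' hFc

theorem core_main [Nonempty M] (hN : NoArr L M β) {P : Ultrafilter (β → M)} {X : Type*} {n : ℕ}
    (θ : X → (β → M) → Prop) (ψ : Fin n → X → (β → M) → Prop) (k : Fin n → ℕ)
    (hsys : ∀ i, IsSys L (fun S => ∃ x, ∀ y ∈ S, ψ i x y))
    (hdv : ∀ i, Dv L P (fun S => ∃ x, ∀ y ∈ S, ψ i x y) (k i))
    (hD0 : Df L (id : M → M) (fun y => ∀ x, θ x y → ∃ i, ψ i x y))
    (hP0 : ∀ᶠ y in (P : Filter (β → M)), ∀ x, θ x y → ∃ i, ψ i x y) :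
    ∃ k', Dv L P (fun S => ∃ x, ∀ y ∈ S, θ x y) k' := by
  classical
  obtain ⟨s, hs, hst⟩ := exists_strict hN P
  have h1 := fun i => kim hN hst (hsys i) (hdv i)
  choose N1 hN1 using h1
  let N0 := Finset.univ.sup N1
  have hN0 : ∀ i, It s (fun S => ¬ ∃ x, ∀ y ∈ S, ψ i x y) N0 ∅ := fun i =>
    It.mono_nat (fun S T hST h h' => h ((hsys i).mono hST h'))
      (Finset.le_sup (f := N1) (Finset.mem_univ i)) (hN1 i)
  refine ⟨n * N0 + 1, fun D hD hDP N => ?_⟩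
  obtain ⟨I, hI, hI'⟩ := exists_row s _ N0 hN0 _ (hs _ (hD.and hD0) (hDP.and hP0)) N
  refine ⟨fun t => I t, fun t => (hI t t.2).1, fun u hu hx => ?_⟩
  obtain ⟨x, hx⟩ := hx
  have hcol : ∀ t : Fin N, ∃ i, t ∈ u → ψ i x (I t) := by
    intro t
    by_cases ht : t ∈ u
    · obtain ⟨i, hi⟩ := (hI t t.2).2 x (hx _ ⟨t, ht, rfl⟩)
      exact ⟨i, fun _ => hi⟩
    · have : u.Nonempty := Finset.card_pos.1 (by omega)
      obtain ⟨t', ht'⟩ := this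
      obtain ⟨i, hi⟩ := (hI t' t'.2).2 x (hx _ ⟨t', ht', rfl⟩)
      exact ⟨i, fun h => absurd h ht⟩
  choose c hc using hcol
  obtain ⟨i, -, hi⟩ := Finset.exists_lt_card_fiber_of_mul_lt_card_of_maps_to
    (s := u) (t := Finset.univ) (f := c) (n := N0) (fun _ _ => Finset.mem_univ _) (by simp [hu])
  obtain ⟨v, hv, hvc⟩ := Finset.exists_subset_card_eq hi.le
  have := hI' i (v.map Fin.valEmbedding) (by
    intro t ht
    obtain ⟨t', -, rfl⟩ := Finset.mem_map.1 ht
    exact Finset.mem_range.2 t'.2) (by simp [hvc])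
  rw [Finset.card_map, hvc, Nat.sub_self] at this
  refine this ⟨x, ?_⟩
  rintro _ ⟨t, ht, rfl⟩
  obtain ⟨t', ht', rfl⟩ := Finset.mem_map.1 ht
  have h2 := Finset.mem_filter.1 (hv ht')
  have := hc t' h2.1
  rw [h2.2] at this
  exact this

end core3

section sat
variable {κ : Cardinal.{u}}

theorem empty_case (hM : IsEmpty M) (B : Set M) : ForkEqDiv L M B := by
  rintro α β φ b ⟨n, γ, ψ, c, hdiv, himp⟩
  refine ⟨1, fun _ => b, fun i γ φ c _ => Iff.rfl, fun s hs hx => ?_⟩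
  obtain ⟨x, hx⟩ := hx
  obtain ⟨t, ht⟩ := Finset.card_pos.1 (show 0 < s.card by omega)
  obtain ⟨i, hi⟩ := himp x (hx t ht)
  obtain ⟨k, bs, -, hk⟩ := hdiv i
  refine hk (Finset.range k) (by simp) ⟨x, fun t _ => ?_⟩
  have : bs t = c i := funext fun j => (hM.false (c i j)).elim
  rw [this]
  exact hi

theorem sat [Nonempty M] (hM : IsMonster L M κ) (A : Set M) (hA : Cardinal.mk A < κ) {ν : Type u}
    (hν : Cardinal.mk ν < κ) {ι : Type*} (Q : ι → (ν → M) → Prop)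
    (hQ : ∀ i, Df L (Subtype.val : A → M) (Q i))
    (fin : ∀ s : Finset ι, ∃ x, ∀ i ∈ s, Q i x) : ∃ x, ∀ i, Q i x := by
  classical
  let m0 : M := Classical.arbitrary M
  let A' : Set M := insert m0 A
  have hA' : Cardinal.mk A' < κ := by
    refine (Cardinal.mk_insert_le (s := A) (a := m0)).trans_lt ?_
    exact Cardinal.add_lt_of_lt hM.aleph0_lt.le hA (Cardinal.one_lt_aleph0.trans hM.aleph0_lt)
  have : Nonempty A' := ⟨⟨m0, Set.mem_insert _ _⟩⟩
  have hQ' := fun i => ((hQ i).params (a' := (Subtype.val : A' → M))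
    (fun x => ⟨x.1, Set.mem_insert_of_mem _ x.2⟩) (fun _ => rfl)).seq
  choose φ b hb hφ using hQ'
  obtain ⟨x, hx⟩ := hM.saturated A' hA' ν hν (Set.range fun i => (φ i, b i)) (by
      rintro _ ⟨i, rfl⟩
      simpa using hb i) (by
      intro l hl
      have : ∃ s : Finset ι, ∀ q ∈ l, ∃ i ∈ s, (φ i, b i) = q := by
        induction l with
        | nil => exact ⟨∅, by simp⟩
        | cons q l ih =>
          obtain ⟨s, hs⟩ := ih (fun q hq => hl q (by simp [hq]))
          obtain ⟨i, hi⟩ := hl q (by simp)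
          refine ⟨insert i s, fun q' hq' => ?_⟩
          rcases List.mem_cons.1 hq' with rfl | hq'
          · exact ⟨i, by simp, hi⟩
          · obtain ⟨i', h1, h2⟩ := hs q' hq'
            exact ⟨i', by simp [h1], h2⟩
      obtain ⟨s, hs⟩ := this
      obtain ⟨x, hx⟩ := fin s
      refine ⟨x, fun q hq => ?_⟩
      obtain ⟨i, hi, rfl⟩ := hs q hq
      exact (hφ i x).1 (hx i hi))
  exact ⟨x, fun i => (hφ i x).2 (hx _ ⟨i, rfl⟩)⟩

theorem df_cons [Nonempty M] {A : Type*} {a : A → M} {α β' V : Type*} (φ : L.Formula (α ⊕ β')) {J : Type*} [Finite J]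
    (τ : J → β' → V ⊕ A) :
    Df L a (fun v : V → M => ∃ x : α → M, ∀ j,
      φ.Realize (Sum.elim x (fun i => Sum.elim v a (τ j i)))) := by
  have h1 : Df L a (fun v : V ⊕ α → M => ∀ j : J,
      φ.Realize (fun i => Sum.elim v a (Sum.elim (fun z => Sum.inl (Sum.inr z))
        (fun i => Sum.map Sum.inl id (τ j i)) i))) :=
    Df.all fun j => (Df.of_formula φ).subst _
  refine h1.ex.congr fun v => exists_congr fun z => forall_congr' fun j => iff_of_eq ?_
  congr 1
  funext i
  rcases i with i | i
  · simp
  · simp only [Sum.elim_inr]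
    rcases τ j i with x | x <;> simp

theorem sys_fin [Nonempty M] {β : Type u} {K : Set (β → M) → Prop} (hK : IsSys L K) :
    ∃ (m : ℕ) (φ : L.Formula (Fin m ⊕ Fin m)) (c : (β → M) → Fin m → M),
      ∀ S, K S ↔ ∃ x : Fin m → M, ∀ y ∈ S, φ.Realize (Sum.elim x (c y)) := by
  classical
  obtain ⟨ζ, θ, ⟨φ, hφ⟩, hK⟩ := hK
  obtain ⟨s, φ', hs⟩ := fin_vars (M := M) φ
  let m0 : M := Classical.arbitrary M
  let e := s.equivFin
  let g : s → Fin s.card ⊕ Fin s.card := fun i => match i.1 with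
    | Sum.inl (Sum.inl _) => Sum.inl (e i)
    | Sum.inl (Sum.inr _) => Sum.inr (e i)
    | Sum.inr _ => Sum.inr (e i)
  let c : (β → M) → Fin s.card → M := fun y j => match (e.symm j).1 with
    | Sum.inl (Sum.inl _) => m0
    | Sum.inl (Sum.inr b) => y b
    | Sum.inr m => m
  have key : ∀ (z : ζ → M) (x : Fin s.card → M),
      (∀ i (h : Sum.inl (Sum.inl i) ∈ s), x (e ⟨_, h⟩) = z i) → ∀ y,
      (φ'.relabel g).Realize (Sum.elim x (c y)) ↔ θ (Sum.elim z y) := by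
    intro z x hzx y
    rw [hφ, hs, FirstOrder.Language.Formula.realize_relabel]
    apply iff_of_eq
    congr 1
    funext i
    rcases i with ⟨(i | i) | i, hi⟩
    · simpa [g] using hzx i hi
    · simp [g, c]
    · simp [g, c]
  refine ⟨s.card, φ'.relabel g, c, fun S => ?_⟩
  rw [hK]
  constructor
  · rintro ⟨z, hz⟩
    let x : Fin s.card → M := fun j => match (e.symm j).1 with
      | Sum.inl (Sum.inl i) => z i
      | Sum.inl (Sum.inr _) => m0
      | Sum.inr _ => m0
    exact ⟨x, fun y hy => (key z x (fun i h => by simp [x]) y).2 (hz y hy)⟩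
  · rintro ⟨x, hx⟩
    refine ⟨fun i => if h : Sum.inl (Sum.inl i) ∈ s then x (e ⟨_, h⟩) else m0, fun y hy => ?_⟩
    exact (key _ x (fun i h => by simp [h]) y).1 (hx y hy)

theorem noArr [Nonempty M] (hM : IsMonster L M κ) (hT : NTP2 L M) (β : Type u) : NoArr L M β := by
  classical
  intro K k hK hArr
  obtain ⟨m, φ, c, hc⟩ := sys_fin hK
  apply hT
  let Q : (ℕ × {F : Finset ℕ // F.card = k}) ⊕ (ℕ × (ℕ → ℕ)) → (ULift.{u} (ℕ × ℕ × Fin m) → M) → Prop :=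
    Sum.elim (fun q v => ¬ ∃ x : Fin m → M, ∀ i : q.2.1,
        φ.Realize (Sum.elim x (fun l => v (ULift.up (i.1, q.1, l)))))
      (fun q v => ∃ x : Fin m → M, ∀ j : Fin q.1,
        φ.Realize (Sum.elim x (fun l => v (ULift.up (q.2 j, (j : ℕ), l)))))
  have hcount : Cardinal.mk (ULift.{u} (ℕ × ℕ × Fin m)) < κ :=
    (Cardinal.mk_le_aleph0).trans_lt hM.aleph0_lt
  obtain ⟨v, hv⟩ := sat hM ∅ (by
      rw [Cardinal.mk_eq_zero]
      exact Cardinal.aleph0_pos.trans hM.aleph0_lt) hcount Q (by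
      rintro (q | q)
      · exact (df_cons φ (fun (i : q.2.1) l => Sum.inl (ULift.up (i.1, q.1, l)))).not
      · exact df_cons φ (fun (j : Fin q.1) l => Sum.inl (ULift.up (q.2 j, (j : ℕ), l)))) (by
      intro s
      let b : (ℕ × {F : Finset ℕ // F.card = k}) ⊕ (ℕ × (ℕ → ℕ)) → ℕ :=
        Sum.elim (fun q => q.1 + q.2.1.sup id + 1) (fun q => q.1 + (Finset.range q.1).sup q.2 + 1)
      obtain ⟨A, hA, hA'⟩ := hArr (s.sup b) (s.sup b)
      refine ⟨fun q => if h : q.down.1 < s.sup b ∧ q.down.2.1 < s.sup b then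
        c (A ⟨_, h.2⟩ ⟨_, h.1⟩) q.down.2.2 else Classical.arbitrary M, fun i hi => ?_⟩
      have hbi : b i ≤ s.sup b := Finset.le_sup hi
      generalize hB : s.sup b = B at *
      rcases i with ⟨j, F, hF⟩ | ⟨N, f⟩
      · simp only [b, Sum.elim_inl] at hbi
        rintro ⟨x, hx⟩
        have hFB : ∀ i ∈ F, i < B := fun i hi => by
          have := Finset.le_sup (f := id) hi
          simp only [id] at this
          omega
        refine hA ⟨j, by omega⟩ (F.attachFin hFB) (by simpa using hF) ((hc _).2 ⟨x, ?_⟩)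
        rintro _ ⟨i, hi, rfl⟩
        have := hx ⟨i, by simpa using hi⟩
        have hj : j < B := by omega
        simpa [hj] using this
      · simp only [b, Sum.elim_inr] at hbi
        have hfB : ∀ j < N, f j < B := fun j hj => by
          have := Finset.le_sup (f := f) (Finset.mem_range.2 hj)
          omega
        obtain ⟨x, hx⟩ := (hc _).1 (hA' (fun j => if h : f j < B then ⟨f j, h⟩ else j))
        refine ⟨x, fun j => ?_⟩
        have hj : (j : ℕ) < B := by have := j.2; omega
        have := hx _ ⟨⟨j, hj⟩, rfl⟩
        simpa [hj, hfB j j.2] using this)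
  refine ⟨m, m, k, φ, fun i j l => v (ULift.up (i, j, l)), fun j F hF => ?_, fun f => ?_⟩
  · have := hv (Sum.inl (j, ⟨F, hF⟩))
    simpa [Q] using this
  · have hR : Cardinal.mk (Set.range v) < κ := Cardinal.mk_range_le.trans_lt hcount
    obtain ⟨x, hx⟩ := sat hM (Set.range v) hR (ν := ULift.{u} (Fin m))
      (Cardinal.mk_le_aleph0.trans_lt hM.aleph0_lt)
      (fun (j : ℕ) (x : ULift.{u} (Fin m) → M) => φ.Realize (Sum.elim (fun i => x (ULift.up i))
        (fun l => v (ULift.up (f j, j, l))))) (by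
        intro j
        refine ((Df.of_formula φ).subst (Sum.elim (fun i => Sum.inl (ULift.up i))
          (fun l => Sum.inr ⟨v (ULift.up (f j, j, l)), ⟨_, rfl⟩⟩))).congr fun x => iff_of_eq ?_
        congr 1
        funext i
        rcases i with i | i <;> simp) (by
        intro s
        obtain ⟨x, hx⟩ := hv (Sum.inr (s.sup id + 1, f))
        refine ⟨fun i => x i.down, fun j hj => ?_⟩
        have hj' : j < s.sup id + 1 := by
          have := Finset.le_sup (f := id) hj
          simp only [id] at this
          omega
        exact hx ⟨j, hj'⟩)
    exact ⟨fun i => x (ULift.up i), hx⟩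

end sat

section bridge
variable {κ : Cardinal.{u}} {α β : Type u}

/-- consistency predicate of a formula -/
def KK {L : FirstOrder.Language.{u, u}} {M : Type u} [L.Structure M] {α β : Type u}
    (ψ : L.Formula (α ⊕ β)) (S : Set (β → M)) : Prop :=
  ∃ x : α → M, ∀ y ∈ S, ψ.Realize (Sum.elim x y)

theorem KK.sys (ψ : L.Formula (α ⊕ β)) : IsSys L (KK (M := M) ψ) :=
  ⟨α, fun v => ψ.Realize v, Df.of_formula ψ, fun _ => Iff.rfl⟩

/-- no long rows inside `D` -/
def NoRow {L : FirstOrder.Language.{u, u}} {M : Type u} [L.Structure M] {α β : Type u}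
    (ψ : L.Formula (α ⊕ β)) (k N : ℕ) (D : (β → M) → Prop) : Prop :=
  ¬ ∃ I : Fin N → β → M, (∀ t, D (I t)) ∧ Kinc (KK ψ) k I

theorem df_noRow [Nonempty M] {A V : Type*} {a : A → M} (ψ : L.Formula (α ⊕ β)) (k N : ℕ)
    (δ : L.Formula (β ⊕ ℕ)) (τ : ℕ → V) :
    Df L a (fun v : V → M => NoRow ψ k N (fun y => δ.Realize (Sum.elim y (fun n => v (τ n))))) := by
  have h1 : Df L a (fun v : V ⊕ (Fin N × β) → M =>
      (∀ t, δ.Realize (fun q => v (Sum.elim (fun i => Sum.inr (t, i)) (fun n => Sum.inl (τ n)) q))) ∧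
      ∀ s : Finset (Fin N), s.card = k → ¬ ∃ x : α → M, ∀ t : s,
        ψ.Realize (Sum.elim x (fun i => Sum.elim v a (Sum.inl (Sum.inr (t.1, i)))))) := by
    refine (Df.all fun t => (Df.of_formula δ).substV _).and (Df.all fun s => (Df.triv _).imp ?_)
    exact (df_cons ψ (fun (t : s) i => Sum.inl (Sum.inr (t.1, i)))).not
  refine h1.ex.not.congr fun v => not_congr ?_
  have e1 : ∀ (w : Fin N × β → M) (t : Fin N),
      (fun q => Sum.elim v w (Sum.elim (fun i => Sum.inr (t, i)) (fun n => Sum.inl (τ n)) q))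
        = Sum.elim (fun i => w (t, i)) (fun n => v (τ n)) := by
    intro w t
    funext q
    rcases q with q | q <;> simp
  simp only [e1]
  constructor
  · rintro ⟨I, hI, hk⟩
    refine ⟨fun q => I q.1 q.2, hI, fun s hs hx => hk s hs ?_⟩
    obtain ⟨x, hx⟩ := hx
    refine ⟨x, ?_⟩
    rintro _ ⟨t, ht, rfl⟩
    exact hx ⟨t, ht⟩
  · rintro ⟨w, hI, hk⟩
    refine ⟨fun t i => w (t, i), hI, fun s hs hx => hk s hs ?_⟩
    obtain ⟨x, hx⟩ := hx
    exact ⟨x, fun t => hx _ ⟨t.1, t.2, rfl⟩⟩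

theorem Df.formula {V : Type*} {Q : (V → M) → Prop} (h : Df L (PEmpty.elim.{_, u+1} : PEmpty.{u+1} → M) Q) :
    ∃ φ : L.Formula V, ∀ v, Q v ↔ φ.Realize v := by
  obtain ⟨φ, hφ⟩ := h
  refine ⟨φ.relabel (Sum.elim id PEmpty.elim), fun v => ?_⟩
  rw [hφ, FirstOrder.Language.Formula.realize_relabel]
  apply iff_of_eq
  congr 1
  funext i
  rcases i with i | i
  · rfl
  · exact i.elim

theorem TpForks.relabel {B P P' : Set M} {ζ ζ' : Type u} {d : ζ → M} {d' : ζ' → M} (f : ζ → ζ')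
    (hf : ∀ i, d' (f i) = d i) (hP : P ⊆ P') (h : TpForks L M B d P) : TpForks L M B d' P' := by
  obtain ⟨γ, φ, b, hb, hφ, n, γ', ψ, c, hdiv, himp⟩ := h
  have e : ∀ {γ : Type u} (x : ζ' → M) (b : γ → M),
      Sum.elim x b ∘ Sum.map f id = Sum.elim (fun i => x (f i)) b := by
    intro γ x b
    funext i
    rcases i with i | i <;> rfl
  refine ⟨γ, φ.relabel (Sum.map f id), b, hb.trans hP, ?_, n, γ',
    fun i => (ψ i).relabel (Sum.map f id), c, fun i => ?_, fun x hx => ?_⟩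
  · rw [FirstOrder.Language.Formula.realize_relabel, e]
    simpa only [hf] using hφ
  · obtain ⟨k, bs, h1, h2⟩ := hdiv i
    refine ⟨k, bs, h1, fun s hs hx => h2 s hs ?_⟩
    obtain ⟨x, hx⟩ := hx
    refine ⟨fun i => x (f i), fun t ht => ?_⟩
    have := hx t ht
    rwa [FirstOrder.Language.Formula.realize_relabel, e] at this
  · rw [FirstOrder.Language.Formula.realize_relabel, e] at hx
    obtain ⟨i, hi⟩ := himp _ hx
    refine ⟨i, ?_⟩
    rwa [FirstOrder.Language.Formula.realize_relabel, e]

theorem ext_base [Nonempty M] (hM : IsMonster L M κ) (B : Set M) (hB : Cardinal.mk B < κ)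
    (hbase : ∀ (α : Type u) (a : α → M), IstIndep L M κ B a B) {ζ : Type u} (hζ : Cardinal.mk ζ < κ)
    (d : ζ → M) : ¬ TpForks L M B d B := by
  classical
  intro h
  obtain ⟨p, -, -, hp⟩ := hbase PUnit (fun _ => Classical.arbitrary M)
  have hC : Cardinal.mk (B ∪ Set.range d : Set M) < κ :=
    (Cardinal.mk_union_le _ _).trans_lt (Cardinal.add_lt_of_lt hM.aleph0_lt.le hB
      (Cardinal.mk_range_le.trans_lt hζ))
  obtain ⟨c, hc⟩ := hM.saturated (B ∪ Set.range d) hC PUnit (by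
      rw [Cardinal.mk_punit]
      exact Cardinal.one_lt_aleph0.trans hM.aleph0_lt)
    {q | p.mem q.1 q.2 ∧ Set.range q.2 ⊆ B ∪ Set.range d} (fun q hq => hq.2)
    (fun l hl => p.finsat l fun q hq => (hl q hq).1)
  refine hp (B ∪ Set.range d) Set.subset_union_left c (fun φ b h1 h2 => hc (φ, b) ⟨h1, h2⟩) ?_
  exact h.relabel (fun i => ⟨d i, Or.inr ⟨i, rfl⟩⟩) (fun _ => rfl) Set.subset_union_left

theorem exists_P [Nonempty M] (hM : IsMonster L M κ) (B : Set M) (hB : Cardinal.mk B < κ)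
    (hbase : ∀ (α : Type u) (a : α → M), IstIndep L M κ B a B) (a : β → M) (α : Type u) :
    ∃ P : Ultrafilter (β → M),
      (∀ E : (β → M) → Prop, Df L (Subtype.val : B → M) E → E a → ∀ᶠ y in (P : Filter (β → M)), E y) ∧
      ∀ (ψ : L.Formula (α ⊕ β)) (k : ℕ), KDivides L M B k ψ a → Dv L P (KK ψ) k := by
  classical
  let ι₁ := {E : (β → M) → Prop // Df L (Subtype.val : B → M) E ∧ E a}
  let ι₂ := {D : (β → M) → Prop // Df L (id : M → M) D ∧
    ∃ (ψ : L.Formula (α ⊕ β)) (k N : ℕ), KDivides L M B k ψ a ∧ NoRow ψ k N D}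
  obtain ⟨P, hP⟩ := exists_ultra (X := β → M) (ι := ι₁ ⊕ ι₂)
    (Sum.elim (fun D y => D.1 y) (fun G y => ¬ G.1 y)) (by
      intro s
      by_contra hc
      push Not at hc
      have f1 : Finite {i : ι₁ // Sum.inl i ∈ s} :=
        Finite.of_injective (β := s) (fun w => ⟨Sum.inl w.1, w.2⟩)
          (fun x y hxy => Subtype.ext (by simpa using hxy))
      have f2 : Finite {i : ι₂ // Sum.inr i ∈ s} :=
        Finite.of_injective (β := s) (fun w => ⟨Sum.inr w.1, w.2⟩)
          (fun x y hxy => Subtype.ext (by simpa using hxy))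
      obtain ⟨r, ⟨e⟩⟩ := Finite.exists_equiv_fin {i : ι₂ // Sum.inr i ∈ s}
      have hG : ∀ i : Fin r, ∃ (δ : L.Formula (β ⊕ ℕ)) (d : ℕ → M) (ψ : L.Formula (α ⊕ β)) (k N : ℕ),
          (∀ y, (e.symm i).1.1 y ↔ δ.Realize (Sum.elim y d)) ∧ KDivides L M B k ψ a ∧
          NoRow ψ k N (fun y => δ.Realize (Sum.elim y d)) := by
        intro i
        obtain ⟨h1, ψ, k, N, h2, h3⟩ := (e.symm i).1.2
        obtain ⟨δ, d, -, hd⟩ := h1.seq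
        refine ⟨δ, d, ψ, k, N, hd, h2, ?_⟩
        have : (fun y => δ.Realize (Sum.elim y d)) = (e.symm i).1.1 :=
          funext fun y => propext (hd y).symm
        rw [this]
        exact h3
      choose δ d ψ k N hδ hdiv hno using hG
      let E0 : (β → M) → Prop := fun y => ∀ i : {i : ι₁ // Sum.inl i ∈ s}, i.1.1 y
      have hE0 : Df L (Subtype.val : B → M) E0 := Df.all fun i => i.1.2.1
      have hE0a : E0 a := fun i => i.1.2.2
      have hcov : ∀ y, E0 y → ∃ j, (δ j).Realize (Sum.elim y (d j)) := by
        intro y hy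
        obtain ⟨i, hi, hi'⟩ := hc y
        rcases i with i | i
        · exact absurd (hy ⟨i, hi⟩) hi'
        · refine ⟨e ⟨i, hi⟩, (hδ _ _).1 ?_⟩
          simpa using hi'
      let Z := ULift.{u} (Fin r × ℕ)
      have hρ : Df L (Subtype.val : B → M) (fun z : Z → M =>
          (∀ y, E0 y → ∃ j, (δ j).Realize (Sum.elim y (fun n => z (ULift.up (j, n))))) ∧
          ∀ j, NoRow (ψ j) (k j) (N j) (fun y => (δ j).Realize
            (Sum.elim y (fun n => z (ULift.up (j, n)))))) := by
        refine Df.and ?_ (Df.all fun j => df_noRow _ _ _ _ _)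
        have : Df L (Subtype.val : B → M) (fun v : Z ⊕ β → M => E0 (fun i => v (Sum.inr i)) →
            ∃ j, (δ j).Realize (fun q => v (Sum.elim Sum.inr
              (fun n => Sum.inl (ULift.up (j, n))) q))) :=
          (hE0.substV _).imp (Df.exi fun j => (Df.of_formula (δ j)).substV _)
        refine this.alls.congr fun z => forall_congr' fun y => imp_congr Iff.rfl
          (exists_congr fun j => iff_of_eq ?_)
        congr 1
        funext q
        rcases q with q | q <;> simp
      have hχ : ∀ j, ∃ χ : L.Formula (Z ⊕ β), ∀ v : Z ⊕ β → M, ((δ j).Realize (fun q => v (Sum.elim Sum.inr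
              (fun n => Sum.inl (ULift.up (j, n))) q)) ∧
            NoRow (ψ j) (k j) (N j) (fun y => (δ j).Realize
              (Sum.elim y (fun n => v (Sum.inl (ULift.up (j, n)))))) ↔ χ.Realize v) := fun j =>
        Df.formula (((Df.of_formula (δ j)).substV _).and
          (df_noRow _ _ _ _ (fun n => Sum.inl (ULift.up (j, n)))))
      choose χ hχ using hχ
      have hχ' : ∀ j (z : Z → M) (y : β → M), (χ j).Realize (Sum.elim z y) ↔
          (δ j).Realize (Sum.elim y (fun n => z (ULift.up (j, n)))) ∧
            NoRow (ψ j) (k j) (N j) (fun y => (δ j).Realize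
              (Sum.elim y (fun n => z (ULift.up (j, n))))) := by
        intro j z y
        rw [← hχ]
        refine and_congr (iff_of_eq ?_) Iff.rfl
        congr 1
        funext q
        rcases q with q | q <;> simp
      obtain ⟨ρ, hρ⟩ := hρ
      refine ext_base hM B hB hbase (ζ := Z) (Cardinal.mk_le_aleph0.trans_lt hM.aleph0_lt)
        (fun q => d q.down.1 q.down.2) ⟨B, ρ, Subtype.val, by simp, (hρ _).1 ⟨hcov, hno⟩, ?_⟩
      refine ⟨r, fun _ => β, χ, fun _ => a, fun j => ?_, fun z hz => ?_⟩
      · obtain ⟨ys, hys, hinc⟩ := hdiv j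
        refine ⟨N j, ys, hys, fun u hu hz => ?_⟩
        obtain ⟨z, hz⟩ := hz
        simp only [hχ'] at hz
        by_cases hu' : u.Nonempty
        · obtain ⟨t0, ht0⟩ := hu'
          refine (hz t0 ht0).2 ⟨fun t => ys (u.orderEmbOfFin hu t),
            fun t => (hz _ (Finset.orderEmbOfFin_mem u hu t)).1, fun w hw hx => ?_⟩
          obtain ⟨x, hx⟩ := hx
          refine hinc (w.map (u.orderEmbOfFin hu).toEmbedding) (by simpa using hw) ⟨x, fun t ht => ?_⟩
          obtain ⟨t', ht', rfl⟩ := Finset.mem_map.1 ht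
          exact hx _ ⟨t', ht', rfl⟩
        · have hu0 : u = ∅ := Finset.not_nonempty_iff_eq_empty.1 hu'
          subst hu0
          have hN0 : N j = 0 := by simpa using hu.symm
          refine hno j ⟨fun t => absurd t.2 (by omega), fun t => absurd t.2 (by omega), fun w hw hx => ?_⟩
          have hw0 : w = ∅ := Finset.eq_empty_of_forall_notMem fun t => absurd t.2 (by omega)
          subst hw0
          obtain ⟨x, -⟩ := hx
          exact hinc ∅ (by simpa using hw) ⟨x, by simp⟩
      · obtain ⟨h1, h2⟩ := (hρ z).2 hz
        obtain ⟨j, hj⟩ := h1 a hE0a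
        exact ⟨j, (hχ' _ _ _).2 ⟨hj, h2 j⟩⟩)
  refine ⟨P, fun E hE ha => hP (Sum.inl ⟨E, hE, ha⟩), fun ψ k hdiv D hD hDP N => ?_⟩
  by_contra hno
  exact (Ultrafilter.eventually_not.1 (hP (Sum.inr ⟨D, hD, ψ, k, N, hdiv, hno⟩))) hDP

theorem div_of_dv [Nonempty M] (hM : IsMonster L M κ) (B : Set M) (hB : Cardinal.mk B < κ)
    (hβ : Cardinal.mk β < κ) (a : β → M) {P : Ultrafilter (β → M)}
    (hP : ∀ E : (β → M) → Prop, Df L (Subtype.val : B → M) E → E a →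
      ∀ᶠ y in (P : Filter (β → M)), E y)
    (φ : L.Formula (α ⊕ β)) (k : ℕ) (h : Dv L P (KK φ) k) : KDivides L M B k φ a := by
  classical
  let ι₁ := {E : (β → M) → Prop // Df L (Subtype.val : B → M) E ∧ E a}
  let Q : (ι₁ × ℕ) ⊕ {F : Finset ℕ // F.card = k} → (ULift.{u} ℕ × β → M) → Prop :=
    Sum.elim (fun q v => q.1.1 (fun i => v (ULift.up q.2, i)))
      (fun F v => ¬ ∃ x : α → M, ∀ t : F.1, φ.Realize (Sum.elim x (fun i => v (ULift.up t.1, i))))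
  obtain ⟨v, hv⟩ := sat hM B hB (ν := ULift.{u} ℕ × β) (by
      rw [Cardinal.mk_prod, Cardinal.lift_id, Cardinal.lift_id]
      exact Cardinal.mul_lt_of_lt hM.aleph0_lt.le (Cardinal.mk_le_aleph0.trans_lt hM.aleph0_lt) hβ)
    Q (by
      rintro (⟨⟨E, hE, ha⟩, t⟩ | F)
      · exact hE.substV _
      · exact (df_cons φ (fun (t : F.1) i => Sum.inl (ULift.up t.1, i))).not) (by
      intro s
      have f1 : Finite {i : ι₁ × ℕ // Sum.inl i ∈ s} :=
        Finite.of_injective (β := s) (fun w => ⟨Sum.inl w.1, w.2⟩)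
          (fun x y hxy => Subtype.ext (by simpa using hxy))
      let b : (ι₁ × ℕ) ⊕ {F : Finset ℕ // F.card = k} → ℕ :=
        Sum.elim (fun _ => 0) (fun F => F.1.sup id + 1)
      have hDf : Df L (Subtype.val : B → M)
          (fun y => ∀ i : {i : ι₁ × ℕ // Sum.inl i ∈ s}, i.1.1.1 y) := Df.all fun i => i.1.1.2.1
      obtain ⟨I, hI, hk⟩ := h _ (hDf.params Subtype.val (fun _ => rfl))
        (hP _ hDf fun i => i.1.1.2.2) (s.sup b)
      refine ⟨fun q => if h : q.1.down < s.sup b then I ⟨_, h⟩ q.2 else a q.2, fun i hi => ?_⟩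
      have hbi : b i ≤ s.sup b := Finset.le_sup hi
      generalize hBd : s.sup b = Bd at *
      rcases i with ⟨E, t⟩ | ⟨F, hF⟩
      · by_cases ht : t < Bd
        · have := hI ⟨t, ht⟩ ⟨(E, t), hi⟩
          simpa [Q, ht] using this
        · simpa [Q, ht] using E.2.2
      · simp only [b, Sum.elim_inr] at hbi
        have hFB : ∀ i ∈ F, i < Bd := fun i hi => by
          have := Finset.le_sup (f := id) hi
          simp only [id] at this
          omega
        rintro ⟨x, hx⟩
        refine hk (F.attachFin hFB) (by simpa using hF) ⟨x, ?_⟩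
        rintro _ ⟨t, ht, rfl⟩
        have := hx ⟨t, by simpa using ht⟩
        simpa using this)
  refine ⟨fun t i => v (ULift.up t, i), fun t γ χ e he => ?_, fun F hF hx => ?_⟩
  · have hχ : Df L (Subtype.val : B → M) (fun y : β → M => χ.Realize (Sum.elim y e)) :=
      Df.params (a := e) ⟨χ, fun _ => Iff.rfl⟩ (fun i => ⟨e i, he ⟨i, rfl⟩⟩) (fun _ => rfl)
    constructor
    · intro h1
      by_contra h2
      exact hv (Sum.inl (⟨_, hχ.not, h2⟩, t)) h1
    · intro h1
      exact hv (Sum.inl (⟨_, hχ, h1⟩, t))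
  · refine hv (Sum.inr ⟨F, hF⟩) ?_
    obtain ⟨x, hx⟩ := hx
    exact ⟨x, fun t => hx t.1 t.2⟩

theorem fin_case [Nonempty M] (hM : IsMonster L M κ) (hT : NTP2 L M) (B : Set M)
    (hB : Cardinal.mk B < κ) (hbase : ∀ (α : Type u) (a : α → M), IstIndep L M κ B a B)
    (hβ : Cardinal.mk β < κ) (a : β → M) {n : ℕ} (φ : L.Formula (α ⊕ β))
    (ψ : Fin n → L.Formula (α ⊕ β)) (hdiv : ∀ i, Divides L M B (ψ i) a)
    (himp : ∀ x : α → M, φ.Realize (Sum.elim x a) → ∃ i, (ψ i).Realize (Sum.elim x a)) :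
    Divides L M B φ a := by
  obtain ⟨P, hP1, hP2⟩ := exists_P hM B hB hbase a α
  choose k hk using hdiv
  have hD0 : ∀ {A : Type u} (a : A → M), Df L a (fun y : β → M =>
      ∀ x : α → M, φ.Realize (Sum.elim x y) → ∃ i, (ψ i).Realize (Sum.elim x y)) := by
    intro A a
    have e : ∀ (y : β → M) (x : α → M), (fun q : α ⊕ β => Sum.elim y x (Sum.swap q)) = Sum.elim x y := by
      intro y x
      funext q
      rcases q with q | q <;> rfl
    have : Df L a (fun v : β ⊕ α → M => φ.Realize (fun q => v (Sum.swap q)) →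
        ∃ i, (ψ i).Realize (fun q => v (Sum.swap q))) :=
      ((Df.of_formula φ).substV _).imp (Df.exi fun i => (Df.of_formula (ψ i)).substV _)
    refine this.alls.congr fun y => ?_
    simp only [e]
  obtain ⟨k', hk'⟩ := core_main (noArr hM hT β) (P := P) (X := α → M)
    (fun x y => φ.Realize (Sum.elim x y)) (fun i x y => (ψ i).Realize (Sum.elim x y)) k
    (fun i => KK.sys (ψ i)) (fun i => hP2 (ψ i) (k i) (hk i)) (hD0 _) (hP1 _ (hD0 _) himp)
  exact ⟨k', div_of_dv hM B hB hβ a hP1 φ k' hk'⟩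

theorem fin_par {β : Type*} (φ : L.Formula (α ⊕ β)) :
    ∃ (s : Finset β) (φ' : L.Formula (α ⊕ s)), ∀ (x : α → M) (b : β → M),
      φ.Realize (Sum.elim x b) ↔ φ'.Realize (Sum.elim x (fun i : s => b i.1)) := by
  classical
  obtain ⟨s, φ', hs⟩ := fin_vars (M := M) φ
  let t : Finset β := s.preimage Sum.inr (Sum.inr_injective.injOn)
  let g : s → α ⊕ t := fun i => match i with
    | ⟨Sum.inl v, _⟩ => Sum.inl v
    | ⟨Sum.inr x, hx⟩ => Sum.inr ⟨x, by simpa [t] using hx⟩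
  refine ⟨t, φ'.relabel g, fun x b => ?_⟩
  rw [FirstOrder.Language.Formula.realize_relabel, hs]
  apply iff_of_eq
  congr 1
  funext i
  rcases i with ⟨i | i, hi⟩ <;> simp [g]

theorem eqType_aut {B : Set M} {σ : M ≃[L] M} (hσ : FixesSet L M σ B) {δ : Type*} (b : δ → M) :
    EqTypeOver L M B (fun i => σ (b i)) b := by
  intro γ φ c hc
  have : Sum.elim (fun i => σ (b i)) c = σ ∘ Sum.elim b c := by
    funext i
    rcases i with i | i
    · rfl
    · exact (hσ _ (hc ⟨i, rfl⟩)).symm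
  rw [this]
  exact FirstOrder.Language.StrongHomClass.realize_formula σ φ

theorem EqTypeOver.comp {B : Set M} {δ δ' : Type u} {b c : δ → M} (h : EqTypeOver L M B b c)
    (f : δ' → δ) : EqTypeOver L M B (fun i => b (f i)) (fun i => c (f i)) := by
  intro γ φ e he
  have key : ∀ b : δ → M, φ.Realize (Sum.elim (fun i => b (f i)) e) ↔
      (φ.relabel (Sum.map f id)).Realize (Sum.elim b e) := by
    intro b
    rw [FirstOrder.Language.Formula.realize_relabel]
    apply iff_of_eq
    congr 1
    funext i
    rcases i with i | i <;> rfl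
  rw [key, key]
  exact h γ _ e he

theorem main_thm (hM : IsMonster L M κ) (hT : NTP2 L M) (B : Set M)
    (hB : Cardinal.mk B < κ) (hbase : ∀ (α : Type u) (a : α → M), IstIndep L M κ B a B) :
    ForkEqDiv L M B := by
  classical
  rcases isEmpty_or_nonempty M with hE | hne
  · exact empty_case hE B
  rintro α β φ b ⟨n, γ, ψ, c, hdiv, himp⟩
  obtain ⟨s, φ', hφ'⟩ := fin_par (M := M) φ
  have hψ := fun i => fin_par (M := M) (ψ i)
  choose S ψ' hψ' using hψ
  let β' : Type u := s ⊕ (Σ i : Fin n, S i)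
  have hβ' : Cardinal.mk β' < κ := (Cardinal.mk_le_aleph0).trans_lt hM.aleph0_lt
  let a : β' → M := Sum.elim (fun j => b j.1) (fun q => c q.1 q.2.1)
  have eφ : ∀ (x : α → M) (y : β' → M), (φ'.relabel (Sum.map id Sum.inl)).Realize (Sum.elim x y) ↔
      φ'.Realize (Sum.elim x (fun j => y (Sum.inl j))) := by
    intro x y
    rw [FirstOrder.Language.Formula.realize_relabel]
    apply iff_of_eq
    congr 1
    funext i
    rcases i with i | i <;> rfl
  have eψ : ∀ i (x : α → M) (y : β' → M),
      ((ψ' i).relabel (Sum.map id (fun j => Sum.inr ⟨i, j⟩))).Realize (Sum.elim x y) ↔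
      (ψ' i).Realize (Sum.elim x (fun j => y (Sum.inr ⟨i, j⟩))) := by
    intro i x y
    rw [FirstOrder.Language.Formula.realize_relabel]
    apply iff_of_eq
    congr 1
    funext i
    rcases i with i | i <;> rfl
  obtain ⟨k, bs, h1, h2⟩ := fin_case hM hT B hB hbase hβ' a (φ'.relabel (Sum.map id Sum.inl))
    (fun i => (ψ' i).relabel (Sum.map id (fun j => Sum.inr ⟨i, j⟩))) (by
      intro i
      obtain ⟨k, bs, h1, h2⟩ := hdiv i
      have hσ := fun t => hM.homogeneous B hB (S i)
        ((Cardinal.mk_le_aleph0).trans_lt hM.aleph0_lt) _ _ ((h1 t).comp (fun j : S i => j.1))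
      choose σ hσ hσ' using hσ
      refine ⟨k, fun t j => (σ t).symm (a j), fun t => ?_, fun F hF hx => h2 F hF ?_⟩
      · refine eqType_aut (σ := (σ t).symm) (fun m hm => ?_) a
        have := hσ t m hm
        exact (σ t).toEquiv.symm_apply_eq.2 this.symm
      · obtain ⟨x, hx⟩ := hx
        refine ⟨x, fun t ht => ?_⟩
        have h3 := (eψ i x _).1 (hx t ht)
        rw [hψ']
        convert h3 using 2
        funext q
        exact ((σ t).toEquiv.symm_apply_eq.2 (hσ' t q).symm).symm) (by
      intro x hx
      obtain ⟨i, hi⟩ := himp x ((hφ' _ _).2 ((eφ _ _).1 hx))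
      exact ⟨i, (eψ i _ _).2 ((hψ' _ _ _).1 hi)⟩)
  have hσ := fun t => hM.homogeneous B hB β' hβ' _ _ (h1 t)
  choose σ hσ hσ' using hσ
  refine ⟨k, fun t j => (σ t).symm (b j), fun t => ?_, fun F hF hx => h2 F hF ?_⟩
  · refine eqType_aut (σ := (σ t).symm) (fun m hm => ?_) b
    have := hσ t m hm
    exact (σ t).toEquiv.symm_apply_eq.2 this.symm
  · obtain ⟨x, hx⟩ := hx
    refine ⟨x, fun t ht => ?_⟩
    have h3 := (hφ' _ _).1 (hx t ht)
    rw [eφ]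
    convert h3 using 2
    funext q
    exact ((σ t).toEquiv.symm_apply_eq.2 (hσ' t (Sum.inl q)).symm).symm

end bridge

end Work

/-- In an NTP₂ theory, if `B` is an extension base for `⫝ⁱˢᵗ`,
then forking equals dividing over `B`. -/
theorem forkEqDiv_of_ist_extension_base
    (κ : Cardinal.{u}) (hM : IsMonster L M κ) (hT : NTP2 L M)
    (B : Set M) (hB : Cardinal.mk B < κ)
    (hbase : ∀ (α : Type u) (a : α → M), IstIndep L M κ B a B) :
    ForkEqDiv L M B := by
  exact main_thm hM hT B hB hbase

end ForkingNTP2
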